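/- arXiv:1507.02370 — 4 statements merged into one kernel-verified Lean document; each statement's English description precedes it below -/
import Mathlib

section
/- Let G = {1, σ} be a group of order 2 and A a G-module that is a finitely generated abelian group. Then the Herbrand quotient h(G, A) = 2^{2r₊(A) - r(A)}, where r(A) = rank(A) and r₊(A) = rank(A^G). -/
variable (G : Type*) [Group G] [Fintype G] (A : Type*) [AddCommGroup A] [DistribMulAction G A]

/-- The norm map `a ↦ ∑_{τ ∈ G} τ • a`. -/
noncomputable def normMap : A →+ A := ∑ τ : G, DistribMulAction.toAddMonoidHom A τ

/-- The map `a ↦ a - σ • a`. -/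
def oneSubMap (σ : G) : A →+ A := AddMonoidHom.id A - DistribMulAction.toAddMonoidHom A σ

/-- The subgroup of `G`-fixed points `A^G`. -/
def fixedSub : AddSubgroup A where
  carrier := {a | ∀ τ : G, τ • a = a}
  zero_mem' := fun τ => smul_zero τ
  add_mem' := fun ha hb τ => by rw [smul_add, ha τ, hb τ]
  neg_mem' := fun ha τ => by rw [smul_neg, ha τ]

/-- `#H¹(G,A)` for `G` cyclic with generator `σ`, computed as `#(ker N_G / (1-σ)A)`. -/
noncomputable def H1card (σ : G) : ℕ :=
  Nat.card ((normMap G A).ker ⧸ ((oneSubMap G A σ).range.addSubgroupOf (normMap G A).ker))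

/-- `#Ĥ⁰(G,A) = (A^G : N_G A)`. -/
noncomputable def H0card : ℕ :=
  Nat.card (fixedSub G A ⧸ ((normMap G A).range.addSubgroupOf (fixedSub G A)))

/-- The Herbrand quotient `h(G,A) = #Ĥ⁰(G,A) / #H¹(G,A)`. -/
noncomputable def herbrand (σ : G) : ℚ := (H0card G A : ℚ) / (H1card G A σ : ℚ)

open Module in
theorem AddSubgroup.index_range_nsmul_eq_pow_finrank_mul_card_ker_of_addEquiv_prod
    {M F T : Type*} [AddCommGroup M] [AddCommGroup F] [AddCommGroup T] [Free ℤ F]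
    [Module.Finite ℤ F] [Finite T] (e : M ≃+ F × T) {n : ℕ} (hn : n ≠ 0) :
    (nsmulAddMonoidHom (α := M) n).range.index =
      n ^ finrank ℤ M * Nat.card (nsmulAddMonoidHom (α := M) n).ker := by
  have hprod : nsmulAddMonoidHom (α := F × T) n =
      (nsmulAddMonoidHom n).prodMap (nsmulAddMonoidHom n) := rfl
  have hker : (nsmulAddMonoidHom (α := F) n).ker = ⊥ := by
    rw [AddMonoidHom.ker_eq_bot_iff]
    intro a b hab
    exact smul_right_injective F (Int.natCast_ne_zero.2 hn) (by simpa using hab)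
  have hrank : finrank ℤ M = finrank ℤ F := by
    have hT : finrank ℤ T = 0 := finrank_eq_zero_iff_isTorsion.2
      (isAddTorsion_iff_isTorsion_int.1 isAddTorsion_of_finite)
    rw [e.toIntLinearEquiv.finrank_eq, ← Submodule.finrank_quotient_add_finrank
      (LinearMap.ker (LinearMap.fst ℤ F T)),
      ((LinearMap.fst ℤ F T).quotKerEquivOfSurjective LinearMap.fst_surjective).finrank_eq,
      LinearMap.ker_fst, LinearMap.finrank_range_of_inj LinearMap.inr_injective, hT, add_zero]
  have hcard : Nat.card (nsmulAddMonoidHom (α := M) n).ker =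
      Nat.card (nsmulAddMonoidHom (α := F × T) n).ker :=
    Nat.card_congr (e.toEquiv.subtypeEquiv fun a => by simp [AddMonoidHom.mem_ker, ← map_nsmul])
  have hindex : (nsmulAddMonoidHom (α := M) n).range.index =
      (nsmulAddMonoidHom (α := F × T) n).range.index := by
    rw [← e.map_range_nsmulAddMonoidHom]
    exact (AddSubgroup.index_map_equiv _ e).symm
  rw [hcard, hindex, hprod, AddMonoidHom.range_prodMap, AddMonoidHom.ker_prodMap,
    AddSubgroup.index_prod, AddSubgroup.index_range_nsmul, AddSubgroup.index_range, hrank, hker,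
    Nat.card_congr (AddSubgroup.prodEquiv _ _).toEquiv, Nat.card_prod, AddSubgroup.card_bot,
    one_mul]

open Module in
/-- For a finitely generated abelian group `M` and `n ≠ 0`, one has
`#(M / nM) = n ^ rank M * #M[n]`. -/
theorem AddSubgroup.index_range_nsmul_eq_pow_finrank_mul_card_ker
    (M : Type*) [AddCommGroup M] [AddGroup.FG M] {n : ℕ} (hn : n ≠ 0) :
    (nsmulAddMonoidHom (α := M) n).range.index =
      n ^ finrank ℤ M * Nat.card (nsmulAddMonoidHom (α := M) n).ker := by
  obtain ⟨r, ι, _, p, hp, e, ⟨f⟩⟩ := AddCommGroup.equiv_free_prod_directSum_zmod M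
  have : ∀ i, NeZero (p i ^ e i) := fun i => ⟨pow_ne_zero _ (hp i).ne_zero⟩
  have : Finite (DirectSum ι fun i => ZMod (p i ^ e i)) :=
    Finite.of_injective _ DFunLike.coe_injective
  exact AddSubgroup.index_range_nsmul_eq_pow_finrank_mul_card_ker_of_addEquiv_prod f hn

theorem AddCommGroup.finite_of_nsmul_eq_zero {M : Type*} [AddCommGroup M] [AddGroup.FG M] {n : ℕ}
    (hn : n ≠ 0) (h : ∀ a : M, n • a = 0) : Finite M :=
  AddCommGroup.finite_of_fg_isAddTorsion M
    fun a => isOfFinAddOrder_iff_nsmul_eq_zero.2 ⟨n, Nat.pos_of_ne_zero hn, h a⟩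

theorem AddSubgroup.fg_of_addGroup_fg {M : Type*} [AddCommGroup M] [AddGroup.FG M]
    (H : AddSubgroup M) : AddGroup.FG H := by
  have : Module.Finite ℤ M := Module.Finite.iff_addGroup_fg.2 inferInstance
  exact Module.Finite.iff_addGroup_fg.1
    (inferInstanceAs (Module.Finite ℤ (AddSubgroup.toIntSubmodule H)))

/-- If `f` agrees with multiplication by `n` on `P` and maps into `P`, then
`[P : nP] = [B : P + ker f] * [P : f B]`. -/
theorem AddSubgroup.index_range_nsmul_eq_index_sup_ker_mul_relIndex {B : Type*} [AddCommGroup B]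
    {f : B →+ B} {P : AddSubgroup B} {n : ℕ} (hf : ∀ a ∈ P, f a = n • a) (hP : f.range ≤ P) :
    (nsmulAddMonoidHom (α := P) n).range.index = (P ⊔ f.ker).index * f.range.relIndex P := by
  have hmap : P.map f = P.map (nsmulAddMonoidHom n) :=
    SetLike.coe_injective (Set.image_congr hf)
  have hle : P.map f ≤ f.range := by
    rintro _ ⟨a, _, rfl⟩
    exact ⟨a, rfl⟩
  have h₁ : (P.map f).relIndex P = (nsmulAddMonoidHom (α := P) n).range.index := by
    rw [hmap, AddSubgroup.relIndex, AddSubgroup.addSubgroupOf_map_nsmulAddMonoidHom_eq_range]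
  have h₂ : (P.map f).relIndex f.range = (P ⊔ f.ker).index := by
    rw [AddMonoidHom.range_eq_map, AddSubgroup.relIndex_map_map, top_sup_eq,
      AddSubgroup.relIndex_top_right]
  rw [← h₁, ← h₂, AddSubgroup.relIndex_mul_relIndex _ _ _ hle hP]

/-- If `f` agrees with multiplication by `n` on `P`, then `#P[n] = #(P ∩ ker f)`. -/
theorem AddSubgroup.card_ker_nsmul_eq_card_inf_ker {B : Type*} [AddCommGroup B]
    {f : B →+ B} {P : AddSubgroup B} {n : ℕ} (hf : ∀ a ∈ P, f a = n • a) :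
    Nat.card (nsmulAddMonoidHom (α := P) n).ker = Nat.card (P ⊓ f.ker : AddSubgroup B) :=
  Nat.card_congr
    { toFun := fun x => ⟨x.1.1, x.1.2, (hf _ x.1.2).trans (congrArg Subtype.val x.2)⟩
      invFun := fun x => ⟨⟨x.1, x.2.1⟩, Subtype.ext ((hf _ x.2.1).symm.trans x.2.2)⟩
      left_inv := fun _ => rfl
      right_inv := fun _ => rfl }

section Involution

variable {B : Type*} [AddCommGroup B] {s : B →+ B}

theorem mem_ker_id_sub {a : B} : a ∈ (AddMonoidHom.id B - s).ker ↔ s a = a := by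
  rw [AddMonoidHom.mem_ker, AddMonoidHom.sub_apply, sub_eq_zero, AddMonoidHom.id_apply, eq_comm]

theorem mem_ker_id_add {a : B} : a ∈ (AddMonoidHom.id B + s).ker ↔ s a = -a := by
  rw [AddMonoidHom.mem_ker, AddMonoidHom.add_apply, AddMonoidHom.id_apply, eq_neg_iff_add_eq_zero,
    add_comm]

theorem two_nsmul_mem_ker_sup_ker (hs : ∀ a, s (s a) = a) (a : B) :
    2 • a ∈ (AddMonoidHom.id B - s).ker ⊔ (AddMonoidHom.id B + s).ker := by
  have h₁ : a + s a ∈ (AddMonoidHom.id B - s).ker := by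
    rw [mem_ker_id_sub, map_add, hs, add_comm]
  have h₂ : a - s a ∈ (AddMonoidHom.id B + s).ker := by
    rw [mem_ker_id_add, map_sub, hs, neg_sub]
  convert AddSubgroup.add_mem_sup h₁ h₂ using 1
  abel

theorem finite_quotient_ker_sup_ker [AddGroup.FG B] (hs : ∀ a, s (s a) = a) :
    Finite (B ⧸ (AddMonoidHom.id B - s).ker ⊔ (AddMonoidHom.id B + s).ker) := by
  refine AddCommGroup.finite_of_nsmul_eq_zero two_ne_zero fun q => ?_
  obtain ⟨a, rfl⟩ := QuotientAddGroup.mk_surjective q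
  rw [← QuotientAddGroup.mk_nsmul, QuotientAddGroup.eq_zero_iff]
  exact two_nsmul_mem_ker_sup_ker hs a

theorem finite_ker_inf_ker [AddGroup.FG B] :
    Finite ((AddMonoidHom.id B - s).ker ⊓ (AddMonoidHom.id B + s).ker : AddSubgroup B) := by
  have := AddSubgroup.fg_of_addGroup_fg ((AddMonoidHom.id B - s).ker ⊓ (AddMonoidHom.id B + s).ker)
  refine AddCommGroup.finite_of_nsmul_eq_zero two_ne_zero fun a => Subtype.ext ?_
  have h := (mem_ker_id_sub.1 a.2.1).symm.trans (mem_ker_id_add.1 a.2.2)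
  simpa [two_nsmul] using eq_neg_iff_add_eq_zero.1 h

theorem finrank_ker_add_finrank_ker [AddGroup.FG B] (hs : ∀ a, s (s a) = a) :
    Module.finrank ℤ (AddMonoidHom.id B - s).ker + Module.finrank ℤ (AddMonoidHom.id B + s).ker =
      Module.finrank ℤ B := by
  have : Module.Finite ℤ B := Module.Finite.iff_addGroup_fg.2 inferInstance
  have hq := finite_quotient_ker_sup_ker hs
  have hi := finite_ker_inf_ker (s := s)
  have h := Submodule.rank_sup_add_rank_inf_eq
    (AddSubgroup.toIntSubmodule (AddMonoidHom.id B - s).ker)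
    (AddSubgroup.toIntSubmodule (AddMonoidHom.id B + s).ker)
  rw [← map_sup, ← map_inf] at h
  simp only [← Module.finrank_eq_rank] at h
  norm_cast at h
  rw [Module.finrank_eq_zero_iff_isTorsion (M := AddSubgroup.toIntSubmodule
    ((AddMonoidHom.id B - s).ker ⊓ (AddMonoidHom.id B + s).ker)) |>.2
    (isAddTorsion_iff_isTorsion_int.1 (@isAddTorsion_of_finite _ _ hi)), add_zero] at h
  rw [← Submodule.finrank_quotient_add_finrank (AddSubgroup.toIntSubmodule
    ((AddMonoidHom.id B - s).ker ⊔ (AddMonoidHom.id B + s).ker)), h,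
    Module.finrank_eq_zero_iff_isTorsion (M := B ⧸ AddSubgroup.toIntSubmodule
      ((AddMonoidHom.id B - s).ker ⊔ (AddMonoidHom.id B + s).ker)) |>.2
    (isAddTorsion_iff_isTorsion_int.1 (@isAddTorsion_of_finite _ _ hq)), zero_add]
  rfl

theorem relIndex_div_relIndex_eq_two_zpow [AddGroup.FG B] (hs : ∀ a, s (s a) = a) :
    ((AddMonoidHom.id B + s).range.relIndex (AddMonoidHom.id B - s).ker : ℚ) /
        (AddMonoidHom.id B - s).range.relIndex (AddMonoidHom.id B + s).ker =
      (2 : ℚ) ^ (2 * (Module.finrank ℤ (AddMonoidHom.id B - s).ker : ℤ) -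
        (Module.finrank ℤ B : ℤ)) := by
  set P := (AddMonoidHom.id B - s).ker with hP
  set M := (AddMonoidHom.id B + s).ker with hM
  have := AddSubgroup.fg_of_addGroup_fg P
  have := AddSubgroup.fg_of_addGroup_fg M
  have := finite_quotient_ker_sup_ker hs
  have := finite_ker_inf_ker (s := s)
  have hfP : ∀ a ∈ P, (AddMonoidHom.id B + s) a = 2 • a := fun a ha => by
    simp [mem_ker_id_sub.1 ha, two_nsmul]
  have hfM : ∀ a ∈ M, (AddMonoidHom.id B - s) a = 2 • a := fun a ha => by
    simp [mem_ker_id_add.1 ha, two_nsmul]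
  have hplus := AddSubgroup.index_range_nsmul_eq_index_sup_ker_mul_relIndex hfP
    (by rintro _ ⟨a, rfl⟩; rw [mem_ker_id_sub]; simp [hs, add_comm])
  have hminus := AddSubgroup.index_range_nsmul_eq_index_sup_ker_mul_relIndex hfM
    (by rintro _ ⟨a, rfl⟩; rw [mem_ker_id_add]; simp [hs])
  rw [AddSubgroup.index_range_nsmul_eq_pow_finrank_mul_card_ker _ two_ne_zero,
    AddSubgroup.card_ker_nsmul_eq_card_inf_ker hfP, ← hM] at hplus
  rw [AddSubgroup.index_range_nsmul_eq_pow_finrank_mul_card_ker _ two_ne_zero,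
    AddSubgroup.card_ker_nsmul_eq_card_inf_ker hfM, ← hP, sup_comm, inf_comm] at hminus
  have hindex : ((P ⊔ M).index : ℚ) ≠ 0 := by
    exact_mod_cast AddSubgroup.index_ne_zero_of_finite
  have hcard : (Nat.card (P ⊓ M : AddSubgroup B) : ℚ) ≠ 0 := by
    exact_mod_cast Nat.card_pos.ne'
  have hrank := finrank_ker_add_finrank_ker hs
  rw [← hP, ← hM] at hrank
  apply_fun ((↑) : ℕ → ℚ) at hplus hminus
  push_cast at hplus hminus
  rw [← mul_div_mul_left _ _ hindex, ← hplus, ← hminus, mul_div_mul_right _ _ hcard,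
    ← zpow_natCast, ← zpow_natCast, ← zpow_sub₀ two_ne_zero, ← hrank]
  congr 1
  push_cast
  ring

end Involution

/-- For `G = {1, σ}` of order 2 and `A` a finitely generated `G`-module,
the Herbrand quotient is `h(G,A) = 2^{2r₊(A) - r(A)}`. -/
theorem herbrand_eq_two_zpow_two_mul_rank_plus_sub_rank
    (hG : Nat.card G = 2) (σ : G) (hσ : σ ≠ 1) [AddGroup.FG A] :
    herbrand G A σ =
      (2 : ℚ) ^ (2 * (Module.finrank ℤ (fixedSub G A) : ℤ) - (Module.finrank ℤ A : ℤ)) := by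
  classical
  have hG' : ∀ τ : G, τ = 1 ∨ τ = σ := fun τ => or_iff_not_imp_left.2 fun hτ =>
    ((Nat.card_eq_two_iff' (1 : G)).1 hG).unique hτ hσ
  have hσσ : σ * σ = 1 := (hG' (σ * σ)).resolve_right fun h => hσ (mul_eq_left.1 h)
  have huniv : (Finset.univ : Finset G) = {1, σ} := by
    ext τ
    simpa using hG' τ
  have hnorm : normMap G A = AddMonoidHom.id A + DistribMulAction.toAddMonoidHom A σ := by
    ext a
    simp [normMap, huniv, Finset.sum_pair hσ.symm]
  have hfix : fixedSub G A = (oneSubMap G A σ).ker := by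
    ext a
    rw [oneSubMap, mem_ker_id_sub]
    refine ⟨fun h => h σ, fun h τ => ?_⟩
    obtain rfl | rfl := hG' τ
    exacts [one_smul _ a, h]
  change ((normMap G A).range.relIndex (fixedSub G A) : ℚ) /
    (oneSubMap G A σ).range.relIndex (normMap G A).ker = _
  rw [hnorm, hfix]
  exact relIndex_div_relIndex_eq_two_zpow fun a => by simp [smul_smul, hσσ]
end

section
/- Let K/F be a quadratic extension of number fields with Galois group G and S-units as above. Then the index (U_{K,S} : U_{F,S} · U_{K,S}⁻) divides 2^{#S_K - #S_F + 1}, where U_{K,S}⁻ = {α ∈ U_{K,S} : N_{K/F}(α) = 1}. -/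
open NumberField IsDedekindDomain

variable (F K : Type*) [Field F] [NumberField F] [Field K] [NumberField K]
  [Algebra F K] [IsGalois F K]

/-- The set of primes of `K` lying above the primes in `SF`. -/
def SKset (SF : Finset (HeightOneSpectrum (𝓞 F))) : Set (HeightOneSpectrum (𝓞 K)) :=
  {w | ∃ v ∈ SF, w.asIdeal.comap (algebraMap (𝓞 F) (𝓞 K)) = v.asIdeal}

/-- `#S_F`, counting the finite primes in `S_F` together with all infinite primes of `F`
(which `S_F` always contains). -/
noncomputable def nSF (SF : Finset (HeightOneSpectrum (𝓞 F))) : ℕ :=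
  SF.card + Nat.card (InfinitePlace F)

/-- `#S_K`, counting the finite primes of `K` above `S_F` together with all infinite
primes of `K`. -/
noncomputable def nSK (SF : Finset (HeightOneSpectrum (𝓞 F))) : ℕ :=
  Nat.card (SKset F K SF) + Nat.card (InfinitePlace K)

/-- The action of `σ ∈ Gal(K/F)` on `Kˣ`. -/
def sigmaU (σ : K ≃ₐ[F] K) : Kˣ →* Kˣ := Units.map σ.toAlgHom.toRingHom.toMonoidHom

/-- The norm map `u ↦ u · σ(u)` on `Kˣ` (for `Gal(K/F) = {1, σ}`). -/
def normU (σ : K ≃ₐ[F] K) : Kˣ →* Kˣ := MonoidHom.id Kˣ * sigmaU F K σ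

/-- The map `u ↦ u / σ(u)` on `Kˣ`. -/
def oneSubU (σ : K ≃ₐ[F] K) : Kˣ →* Kˣ := MonoidHom.id Kˣ / sigmaU F K σ

/-- The subgroup of `Kˣ` fixed by the Galois group of `K/F`. -/
def fixedU : Subgroup Kˣ where
  carrier := {u | ∀ τ : K ≃ₐ[F] K, sigmaU F K τ u = u}
  one_mem' := fun τ => map_one _
  mul_mem' := fun ha hb τ => by rw [map_mul, ha τ, hb τ]
  inv_mem' := fun ha τ => by rw [map_inv, ha τ]

/-- The group `U_{K,S}` of `S_K`-units of `K`. -/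
noncomputable def UKS (SF : Finset (HeightOneSpectrum (𝓞 F))) : Subgroup Kˣ :=
  (SKset F K SF).unit K

/-- The group `U_{F,S}` of `S_F`-units of `F`, realized inside `Kˣ` as the Galois-fixed
`S_K`-units, via `U_{K,S}^G = U_{F,S}`. -/
noncomputable def UFS (SF : Finset (HeightOneSpectrum (𝓞 F))) : Subgroup Kˣ :=
  UKS F K SF ⊓ fixedU F K

/-- The subgroup `U_{K,S}⁻` of norm-one `S_K`-units. -/
noncomputable def UKSminus (σ : K ≃ₐ[F] K) (SF : Finset (HeightOneSpectrum (𝓞 F))) :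
    Subgroup Kˣ :=
  UKS F K SF ⊓ (normU F K σ).ker

/-- The norm subgroup `N U_{K,S}`. -/
noncomputable def NUKS (σ : K ≃ₐ[F] K) (SF : Finset (HeightOneSpectrum (𝓞 F))) :
    Subgroup Kˣ :=
  (UKS F K SF).map (normU F K σ)

/-- `#H¹(G, U_{K,S})` for `G = Gal(K/F) = {1, σ}` of order `2`, computed as
`#({u ∈ U_{K,S} : N u = 1} / {u/σ(u) : u ∈ U_{K,S}})`. -/
noncomputable def H1U (σ : K ≃ₐ[F] K) (SF : Finset (HeightOneSpectrum (𝓞 F))) : ℕ :=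
  Nat.card (UKSminus F K σ SF ⧸
    (((UKS F K SF).map (oneSubU F K σ)).subgroupOf (UKSminus F K σ SF)))

/-- `#Ĥ⁰(G, U_{K,S}) = (U_{F,S} : N U_{K,S})`. -/
noncomputable def H0U (σ : K ≃ₐ[F] K) (SF : Finset (HeightOneSpectrum (𝓞 F))) : ℕ :=
  Nat.card (UFS F K SF ⧸ ((NUKS F K σ SF).subgroupOf (UFS F K SF)))

/-- The Herbrand quotient `h(G, U_{K,S})`. -/
noncomputable def herbrandU (σ : K ≃ₐ[F] K) (SF : Finset (HeightOneSpectrum (𝓞 F))) : ℚ :=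
  (H0U F K σ SF : ℚ) / (H1U F K σ SF : ℚ)

theorem finite_torsion_of_finite_additive (A : Type*) [CommGroup A]
    [Module.Finite ℤ (Additive A)] : Finite (CommGroup.torsion A) := by
  let ι : Additive (CommGroup.torsion A) →ₗ[ℤ] Additive A :=
    (MonoidHom.toAdditive (CommGroup.torsion A).subtype).toIntLinearMap
  have : Module.Finite ℤ (Additive (CommGroup.torsion A)) :=
    .of_injective ι Subtype.val_injective
  refine Module.finite_of_fg_torsion (Additive (CommGroup.torsion A)) fun x => ?_
  obtain ⟨n, hn, hx⟩ := isOfFinOrder_iff_pow_eq_one.mp x.toMul.2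
  refine ⟨⟨n, by simpa using hn.ne'⟩, ?_⟩
  change (n : ℤ) • x = 0
  rw [natCast_zsmul]
  exact Subtype.ext hx

/-- Modulo squares, a finitely generated commutative group with cyclic torsion has order dividing
`2 ^ (r + 1)`, where `r` is its rank. -/
theorem index_range_powMonoidHom_two_dvd {A : Type*} [CommGroup A] [Module.Finite ℤ (Additive A)]
    [Finite (CommGroup.torsion A)] [IsCyclic (CommGroup.torsion A)] :
    (powMonoidHom 2 : A →* A).range.index ∣ 2 ^ (Module.finrank ℤ (Additive A) + 1) := by
  set P := (powMonoidHom 2 : A →* A).range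
  set T := CommGroup.torsion A
  let π : Additive A →ₗ[ℤ] Additive (A ⧸ T) :=
    (MonoidHom.toAdditive (QuotientGroup.mk' T)).toIntLinearMap
  have hπ : Function.Surjective π := QuotientGroup.mk'_surjective T
  have : Module.Finite ℤ (Additive (A ⧸ T)) := .of_surjective π hπ
  have : Module.IsTorsionFree ℤ (Additive (A ⧸ T)) := inferInstance
  have hfree : (P ⊔ T).index ∣ 2 ^ Module.finrank ℤ (Additive A) := by
    have h1 := Subgroup.index_map P (QuotientGroup.mk' T)
    rw [QuotientGroup.ker_mk', QuotientGroup.range_mk', Subgroup.index_top, mul_one] at h1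
    have h2 : P.map (QuotientGroup.mk' T) = (powMonoidHom 2 : A ⧸ T →* A ⧸ T).range := by
      ext x
      constructor
      · rintro ⟨_, ⟨a, rfl⟩, rfl⟩
        exact ⟨a, by simp⟩
      · rintro ⟨b, rfl⟩
        obtain ⟨a, rfl⟩ := QuotientGroup.mk'_surjective T b
        exact ⟨a ^ 2, ⟨a, rfl⟩, by simp⟩
    have h3 := AddSubgroup.index_range_nsmul (Additive (A ⧸ T)) 2
    have h4 : (nsmulAddMonoidHom 2 : Additive (A ⧸ T) →+ _).range =
      (powMonoidHom 2 : A ⧸ T →* A ⧸ T).range.toAddSubgroup := rfl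
    rw [h4, Subgroup.index_toAddSubgroup, ← h2, h1] at h3
    rw [h3]
    refine pow_dvd_pow _ ?_
    rw [← (π.quotKerEquivOfSurjective hπ).finrank_eq]
    exact Submodule.finrank_quotient_le _
  have htors : P.relIndex (P ⊔ T) ∣ 2 := by
    rw [sup_comm, Subgroup.relIndex_sup_right]
    have h1 : (powMonoidHom 2 : T →* T).range ≤ P.subgroupOf T := by
      rintro _ ⟨t, rfl⟩
      exact ⟨t, rfl⟩
    refine (Subgroup.index_dvd_of_le h1).trans ?_
    rw [IsCyclic.index_powMonoidHom_range]
    exact Nat.gcd_dvd_right _ _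
  rw [← Subgroup.relIndex_mul_index (le_sup_left : P ≤ P ⊔ T), pow_succ']
  exact mul_dvd_mul htors hfree

/-- Modulo squares, a finitely generated subgroup of the units of a field has order dividing
`2 ^ (r + 1)`, where `r` is its rank. -/
theorem index_range_powMonoidHom_two_dvd_of_units {L : Type*} [Field L] (A : Subgroup Lˣ)
    [Module.Finite ℤ (Additive A)] :
    (powMonoidHom 2 : A →* A).range.index ∣ 2 ^ (Module.finrank ℤ (Additive A) + 1) := by
  have : Finite (CommGroup.torsion A) := finite_torsion_of_finite_additive A
  have : IsCyclic (CommGroup.torsion A) :=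
    isCyclic_of_injective_ringHom
      ((Units.coeHom L).comp (A.subtype.comp (CommGroup.torsion A).subtype))
      (Units.val_injective.comp (Subtype.val_injective.comp Subtype.val_injective))
  exact index_range_powMonoidHom_two_dvd

/-- The prime of `𝓞 K` obtained by pulling back along an automorphism of `K`. -/
noncomputable def primeComap {L : Type*} [Field L] (e : L ≃+* L)
    (w : HeightOneSpectrum (𝓞 L)) : HeightOneSpectrum (𝓞 L) :=
  w.comap (RingOfIntegers.mapRingEquiv e) (RingOfIntegers.mapRingEquiv e).surjective

theorem intValuation_primeComap {L : Type*} [Field L] [NumberField L] (e : L ≃+* L)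
    (w : HeightOneSpectrum (𝓞 L)) (r : 𝓞 L) :
    (primeComap e w).intValuation r = w.intValuation (RingOfIntegers.mapRingEquiv e r) := by
  set f := RingOfIntegers.mapRingEquiv e
  rcases eq_or_ne r 0 with rfl | hr
  · simp
  rw [HeightOneSpectrum.intValuation_eq_exp_neg_multiplicity _ hr,
    HeightOneSpectrum.intValuation_eq_exp_neg_multiplicity _ (by simpa using hr)]
  congr 3
  refine multiplicity_eq_of_emultiplicity_eq (emultiplicity_eq_emultiplicity_iff.mpr fun n => ?_)
  rw [Ideal.dvd_span_singleton, Ideal.dvd_span_singleton]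
  have h : (primeComap e w).asIdeal = w.asIdeal.map (f.symm : 𝓞 L →+* 𝓞 L) :=
    (Ideal.map_symm f).symm
  rw [h, ← Ideal.map_pow]
  have h' := Ideal.map_symm (I := w.asIdeal ^ n) f
  erw [h']
  rfl

theorem valuation_primeComap {L : Type*} [Field L] [NumberField L] (e : L ≃+* L)
    (w : HeightOneSpectrum (𝓞 L)) (x : L) :
    (primeComap e w).valuation L x = w.valuation L (e x) := by
  obtain ⟨r, s, -, rfl⟩ := IsFractionRing.div_surjective (A := 𝓞 L) x
  have key (r : 𝓞 L) : (primeComap e w).valuation L (algebraMap (𝓞 L) L r) =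
      w.valuation L (e (algebraMap (𝓞 L) L r)) := by
    rw [← RingOfIntegers.mapRingEquiv_apply, HeightOneSpectrum.valuation_of_algebraMap,
      HeightOneSpectrum.valuation_of_algebraMap, intValuation_primeComap]
  rw [map_div₀, map_div₀, map_div₀, key, key]

theorem primeComap_under {F K : Type*} [Field F] [Field K] [Algebra F K] (σ : K ≃ₐ[F] K)
    (w : HeightOneSpectrum (𝓞 K)) :
    (primeComap (σ : K ≃+* K) w).asIdeal.comap (algebraMap (𝓞 F) (𝓞 K)) =
      w.asIdeal.comap (algebraMap (𝓞 F) (𝓞 K)) := by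
  ext x
  have : RingOfIntegers.mapRingEquiv (σ : K ≃+* K) (algebraMap (𝓞 F) (𝓞 K) x) =
      algebraMap (𝓞 F) (𝓞 K) x :=
    RingOfIntegers.ext (σ.commutes (x : F))
  change RingOfIntegers.mapRingEquiv (σ : K ≃+* K) (algebraMap (𝓞 F) (𝓞 K) x) ∈ w.asIdeal ↔ _
  rw [this, Ideal.mem_comap]

/-- The map `u ↦ u · σ(u)` on the units of `𝓞 K`. -/
noncomputable def normUnits {K : Type*} [Field K] (σ : K ≃+* K) :
    Additive (𝓞 K)ˣ →ₗ[ℤ] Additive (𝓞 K)ˣ :=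
  (MonoidHom.toAdditive (MonoidHom.id (𝓞 K)ˣ *
    Units.map (RingOfIntegers.mapRingEquiv σ : 𝓞 K →* 𝓞 K))).toIntLinearMap

theorem finrank_ker_normUnits_add_rank_le {F K : Type*} [Field F] [NumberField F] [Field K]
    [NumberField K] [Algebra F K] (σ : K ≃ₐ[F] K) :
    Module.finrank ℤ (normUnits (σ : K ≃+* K)).ker + Units.rank F ≤ Units.rank K := by
  set N := normUnits (σ : K ≃+* K)
  let g : Additive (𝓞 F)ˣ →ₗ[ℤ] Additive (𝓞 K)ˣ :=
    (MonoidHom.toAdditive (Units.map (algebraMap (𝓞 F) (𝓞 K) : 𝓞 F →* 𝓞 K))).toIntLinearMap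
  have hg : Function.Injective g :=
    Units.map_injective (FaithfulSMul.algebraMap_injective (𝓞 F) (𝓞 K))
  have hNg (x) : N (g x) = g x + g x := by
    refine congrArg (g x + ·) (Units.ext (RingOfIntegers.ext ?_))
    exact σ.commutes (x.toMul : 𝓞 F)
  have hker : Module.finrank ℤ (N ∘ₗ g).ker = 0 := by
    rw [Module.finrank_eq_zero_iff_isTorsion]
    rintro ⟨x, hx⟩
    refine ⟨⟨2, by simp⟩, Subtype.ext (hg ?_)⟩
    have h : N (g x) = 0 := hx
    rw [hNg, ← map_add, ← two_smul ℤ] at h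
    exact h.trans (map_zero g).symm
  have h1 := (N ∘ₗ g).ker.finrank_quotient_add_finrank
  rw [(N ∘ₗ g).quotKerEquivRange.finrank_eq, hker, add_zero, Units.finrank_eq] at h1
  have h2 := N.ker.finrank_quotient_add_finrank
  rw [N.quotKerEquivRange.finrank_eq, Units.finrank_eq] at h2
  have h3 := Submodule.finrank_mono (LinearMap.range_comp_le_range g N)
  omega

theorem finite_SKset (F K : Type*) [Field F] [NumberField F] [Field K] [NumberField K]
    [Algebra F K] (SF : Finset (HeightOneSpectrum (𝓞 F))) : (SKset F K SF).Finite := by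
  have h : SKset F K SF = ⋃ v ∈ SF, {w : HeightOneSpectrum (𝓞 K) |
      w.asIdeal.comap (algebraMap (𝓞 F) (𝓞 K)) = v.asIdeal} := by
    ext w
    simp [SKset]
  rw [h]
  refine SF.finite_toSet.biUnion fun v _ => ?_
  have hv := v.isMaximal
  refine Set.Finite.of_finite_image (f := HeightOneSpectrum.asIdeal)
    ((IsDedekindDomain.primesOver_finite v.asIdeal (𝓞 K)).subset ?_)
    (fun _ _ _ _ h => HeightOneSpectrum.ext h)
  rintro _ ⟨w, hw, rfl⟩
  exact ⟨w.isPrime, ⟨hw.symm⟩⟩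

theorem exists_under_eq {F : Type*} (K : Type*) [Field F] [NumberField F] [Field K]
    [NumberField K] [Algebra F K] (v : HeightOneSpectrum (𝓞 F)) :
    ∃ w : HeightOneSpectrum (𝓞 K), w.asIdeal.comap (algebraMap (𝓞 F) (𝓞 K)) = v.asIdeal := by
  have := v.isMaximal
  obtain ⟨P, hP, h⟩ :=
    Ideal.exists_maximal_ideal_liesOver_of_isIntegral (S := 𝓞 K) v.asIdeal
  exact ⟨⟨P, hP.isPrime, Ideal.ne_bot_of_liesOver_of_ne_bot v.ne_bot P⟩, h.over.symm⟩

theorem mem_range_of_valuation_eq_one {K : Type*} [Field K] [NumberField K] {u : Kˣ}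
    (h : ∀ w : HeightOneSpectrum (𝓞 K), w.valuation K u = 1) :
    ∃ x : (𝓞 K)ˣ, Units.map (algebraMap (𝓞 K) K : 𝓞 K →* K) x = u := by
  obtain ⟨a, ha⟩ := HeightOneSpectrum.mem_integers_of_valuation_le_one K (u : K)
    fun w => (h w).le
  obtain ⟨b, hb⟩ := HeightOneSpectrum.mem_integers_of_valuation_le_one K (u⁻¹ : Kˣ)
    fun w => by rw [Units.val_inv_eq_inv_val, map_inv₀, h w, inv_one]
  have hab : a * b = 1 := FaithfulSMul.algebraMap_injective (𝓞 K) K (by simp [ha, hb])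
  exact ⟨⟨a, b, hab, by rw [mul_comm, hab]⟩, Units.ext ha⟩

/-- The valuations at a family of primes, as a homomorphism to `ℤ`-valued functions. -/
noncomputable def valuationFamily {K ι : Type*} [Field K] [NumberField K]
    (w : ι → HeightOneSpectrum (𝓞 K)) : Additive Kˣ →ₗ[ℤ] (ι → ℤ) :=
  LinearMap.pi fun i => (MonoidHom.toAdditiveLeft (w i).valuationOfNeZero).toIntLinearMap

theorem valuationOfNeZero_primeComap {F K : Type*} [Field F] [Field K] [NumberField K]
    [Algebra F K] (σ : K ≃ₐ[F] K) (w : HeightOneSpectrum (𝓞 K)) (u : Kˣ) :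
    (primeComap (σ : K ≃+* K) w).valuationOfNeZero u = w.valuationOfNeZero (sigmaU F K σ u) := by
  rw [← WithZero.coe_inj, HeightOneSpectrum.valuationOfNeZero_eq,
    HeightOneSpectrum.valuationOfNeZero_eq, valuation_primeComap]
  rfl

/-- A norm-one element with trivial valuation at all primes above `v` other than `w` also has
trivial valuation at `w`. -/
theorem valuationOfNeZero_eq_one_of_normU_eq_one {F K : Type*} [Field F] [Field K] [NumberField K]
    [Algebra F K] (σ : K ≃ₐ[F] K) {u : Kˣ} (hu : normU F K σ u = 1) (w : HeightOneSpectrum (𝓞 K))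
    (h : ∀ w' : HeightOneSpectrum (𝓞 K), w' ≠ w → w'.asIdeal.comap (algebraMap (𝓞 F) (𝓞 K)) =
      w.asIdeal.comap (algebraMap (𝓞 F) (𝓞 K)) → w'.valuationOfNeZero u = 1) :
    w.valuationOfNeZero u = 1 := by
  have hprod : w.valuationOfNeZero u * (primeComap (σ : K ≃+* K) w).valuationOfNeZero u = 1 := by
    rw [valuationOfNeZero_primeComap, ← map_mul]
    exact (congrArg _ hu).trans (map_one _)
  by_cases hw : primeComap (σ : K ≃+* K) w = w
  · rw [hw] at hprod
    have : w.valuationOfNeZero u ^ 2 = 1 := by rw [sq, hprod]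
    exact (pow_eq_one_iff_left two_ne_zero).mp this
  · rwa [h _ hw (primeComap_under σ w), mul_one] at hprod

theorem finite_and_finrank_UKSminus_le {F K : Type*} [Field F] [NumberField F] [Field K]
    [NumberField K] [Algebra F K] (σ : K ≃ₐ[F] K) (SF : Finset (HeightOneSpectrum (𝓞 F))) :
    Module.Finite ℤ (Additive (UKSminus F K σ SF)) ∧
      Module.finrank ℤ (Additive (UKSminus F K σ SF)) + nSF F SF ≤ nSK F K SF := by
  classical
  choose c hc using exists_under_eq (F := F) K
  have hcinj : Function.Injective c := fun v v' h =>
    HeightOneSpectrum.ext (by rw [← hc v, ← hc v', h])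
  let C : Set (HeightOneSpectrum (𝓞 K)) := c '' SF
  let S : Set (HeightOneSpectrum (𝓞 K)) := SKset F K SF \ C
  have hCS : C ⊆ SKset F K SF := by
    rintro _ ⟨v, hv, rfl⟩
    exact ⟨v, hv, hc v⟩
  have hSfin : S.Finite := (finite_SKset F K SF).sdiff
  have : Finite S := hSfin
  have : Fintype S := Fintype.ofFinite S
  have hcard : Nat.card S + SF.card = Nat.card (SKset F K SF) := by
    rw [Nat.card_coe_set_eq, Nat.card_coe_set_eq,
      ← Set.ncard_sdiff_add_ncard_of_subset hCS (finite_SKset F K SF),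
      Set.ncard_image_of_injective _ hcinj, Set.ncard_coe_finset]
  let ι : Additive (UKSminus F K σ SF) →ₗ[ℤ] Additive Kˣ :=
    (MonoidHom.toAdditive (UKSminus F K σ SF).subtype).toIntLinearMap
  have hι : Function.Injective ι := Subtype.val_injective
  let Φ : Additive (UKSminus F K σ SF) →ₗ[ℤ] (S → ℤ) := valuationFamily (fun w : S => w.1) ∘ₗ ι
  let ψ : Additive (𝓞 K)ˣ →ₗ[ℤ] Additive Kˣ :=
    (MonoidHom.toAdditive (Units.map (algebraMap (𝓞 K) K : 𝓞 K →* K))).toIntLinearMap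
  have hψ : Function.Injective ψ :=
    Units.map_injective (FaithfulSMul.algebraMap_injective (𝓞 K) K)
  let E := (normUnits (σ : K ≃+* K)).ker
  have hker (x : Φ.ker) : ι x ∈ E.map ψ := by
    obtain ⟨x, hx⟩ := x
    obtain ⟨u, hu, hN⟩ := x
    have hS (w) (hw : w ∈ S) : w.valuationOfNeZero u = 1 := congrFun hx ⟨w, hw⟩
    have hout (w) (hw : w ∉ SKset F K SF) : w.valuationOfNeZero u = 1 := by
      rw [← WithZero.coe_inj, HeightOneSpectrum.valuationOfNeZero_eq]
      exact hu w hw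
    have hC (w) (hw : w ∉ C) : w.valuationOfNeZero u = 1 := by
      by_cases h : w ∈ SKset F K SF
      exacts [hS w ⟨h, hw⟩, hout w h]
    have hall (w : HeightOneSpectrum (𝓞 K)) : w.valuation K (u : K) = 1 := by
      rw [← HeightOneSpectrum.valuationOfNeZero_eq, ← WithZero.coe_one, WithZero.coe_inj]
      by_cases hw : w ∈ C
      · obtain ⟨v, hv, rfl⟩ := hw
        refine valuationOfNeZero_eq_one_of_normU_eq_one σ hN _ fun w' hne hw' => hC w' ?_
        rintro ⟨v', -, rfl⟩
        rw [hc, hc] at hw'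
        exact hne (by rw [HeightOneSpectrum.ext hw'])
      · exact hC w hw
    obtain ⟨y, hy⟩ := mem_range_of_valuation_eq_one hall
    refine ⟨Additive.ofMul y, ?_, hy⟩
    refine Units.ext (RingOfIntegers.ext ?_)
    have hy' : ((y : 𝓞 K) : K) = u := congrArg Units.val hy
    have hN' : (u : K) * σ u = 1 := congrArg Units.val hN
    change ((y : 𝓞 K) : K) * σ ((y : 𝓞 K) : K) = _
    rw [hy', hN']
    rfl
  let j : Φ.ker →ₗ[ℤ] E.map ψ := (ι ∘ₗ Φ.ker.subtype).codRestrict _ hker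
  have hj : Function.Injective j := fun a b h =>
    Subtype.ext (hι (congrArg (Subtype.val : E.map ψ → Additive Kˣ) h))
  have : Module.Finite ℤ Φ.ker := .of_injective j hj
  have : Module.Finite ℤ (Additive (UKSminus F K σ SF) ⧸ Φ.ker) :=
    .equiv Φ.quotKerEquivRange.symm
  have hfin : Module.Finite ℤ (Additive (UKSminus F K σ SF)) :=
    .of_submodule_quotient Φ.ker
  refine ⟨hfin, ?_⟩
  have h1 := Φ.ker.finrank_quotient_add_finrank
  rw [Φ.quotKerEquivRange.finrank_eq] at h1
  have h2 := Φ.range.finrank_le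
  rw [Module.finrank_fintype_fun_eq_card, ← Nat.card_eq_fintype_card] at h2
  have h3 := LinearMap.finrank_le_finrank_of_injective hj
  rw [← (Submodule.equivMapOfInjective ψ hψ E).finrank_eq] at h3
  have h4 := finrank_ker_normUnits_add_rank_le σ
  have h5 : 0 < Fintype.card (InfinitePlace F) := Fintype.card_pos
  have h6 : 0 < Fintype.card (InfinitePlace K) := Fintype.card_pos
  simp only [Units.rank] at h4
  simp only [nSF, nSK, Nat.card_eq_fintype_card (α := InfinitePlace _)]
  change Module.finrank ℤ E + _ ≤ _ at h4
  omega

/-- For a quadratic extension `K/F` of number fields with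
`Gal(K/F) = {1, σ}`, the index `(U_{K,S} : U_{F,S} · U_{K,S}⁻)` divides
`2^{#S_K - #S_F + 1}`. -/
theorem index_sunits_dvd_two_pow
    (hd : Module.finrank F K = 2) (σ : K ≃ₐ[F] K) (hσ : σ ≠ AlgEquiv.refl)
    (SF : Finset (HeightOneSpectrum (𝓞 F))) :
    Nat.card (UKS F K SF ⧸
        ((UFS F K SF ⊔ UKSminus F K σ SF).subgroupOf (UKS F K SF))) ∣
      2 ^ (nSK F K SF + 1 - nSF F SF) := by
  obtain ⟨hfin, hrank⟩ := finite_and_finrank_UKSminus_le σ SF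
  have hcard : Nat.card (K ≃ₐ[F] K) = 2 := by rw [IsGalois.card_aut_eq_finrank, hd]
  have huniv (τ : K ≃ₐ[F] K) : τ = 1 ∨ τ = σ := by
    obtain ⟨ρ, -, hρ⟩ := (Nat.card_eq_two_iff' (1 : K ≃ₐ[F] K)).mp hcard
    exact or_iff_not_imp_left.mpr fun h => (hρ τ h).trans (hρ σ hσ).symm
  have hσσ (x : K) : σ (σ x) = x := by
    have h : σ ^ 2 = 1 := by rw [← hcard, pow_card_eq_one']
    rw [sq] at h
    exact DFunLike.congr_fun h x
  let A := UKSminus F K σ SF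
  have hA : (powMonoidHom 2 : A →* A).range.index ∣ 2 ^ (nSK F K SF + 1 - nSF F SF) :=
    (index_range_powMonoidHom_two_dvd_of_units A).trans <| pow_dvd_pow 2 <|
      Nat.le_sub_of_add_le <| by
        rw [add_right_comm]
        exact Nat.succ_le_succ hrank
  refine dvd_trans ?_ hA
  have hmem (w : HeightOneSpectrum (𝓞 K)) (hw : w ∉ SKset F K SF) :
      primeComap (σ : K ≃+* K) w ∉ SKset F K SF := by
    rintro ⟨v, hv, h⟩
    exact hw ⟨v, hv, by rw [← h, primeComap_under]⟩
  have hstable (u : Kˣ) (hu : u ∈ UKS F K SF) : sigmaU F K σ u ∈ UKS F K SF := by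
    intro w hw
    have := hu _ (hmem w hw)
    rwa [valuation_primeComap] at this
  have hone (u : Kˣ) (hu : u ∈ UKS F K SF) : oneSubU F K σ u ∈ A := by
    refine ⟨(UKS F K SF).div_mem hu (hstable u hu), ?_⟩
    have : sigmaU F K σ (sigmaU F K σ u) = u := Units.ext (hσσ u)
    change u / sigmaU F K σ u * sigmaU F K σ (u / sigmaU F K σ u) = 1
    rw [map_div, this, div_mul_div_cancel, div_self']
  let δ : UKS F K SF →* A :=
    ((oneSubU F K σ).comp (UKS F K SF).subtype).codRestrict A fun u => hone u u.2
  let q := (QuotientGroup.mk' (powMonoidHom 2 : A →* A).range).comp δ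
  have hq : q.ker ≤ (UFS F K SF ⊔ A).subgroupOf (UKS F K SF) := by
    intro u hu
    obtain ⟨a, ha⟩ := (QuotientGroup.eq_one_iff _).mp hu
    have ha' : (a : Kˣ) ^ 2 = u / sigmaU F K σ u := congrArg Subtype.val ha
    have haN : (a : Kˣ) * sigmaU F K σ a = 1 := a.2.2
    have hfix : sigmaU F K σ (u / a) = u / a := by
      rw [map_div, eq_inv_of_mul_eq_one_right haN, div_inv_eq_mul, eq_div_iff_mul_eq', mul_assoc,
        ← sq, ha', mul_div_cancel]
    have : (u : Kˣ) = u / a * a := by rw [div_mul_cancel]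
    rw [Subgroup.mem_subgroupOf, this]
    refine Subgroup.mul_mem_sup ⟨(UKS F K SF).div_mem u.2 a.2.1, fun τ => ?_⟩ a.2
    rcases huniv τ with rfl | rfl
    · rfl
    · exact hfix
  have : Nat.card (UKS F K SF ⧸ q.ker) ∣ (powMonoidHom 2 : A →* A).range.index :=
    (Nat.card_congr (QuotientGroup.quotientKerEquivRange q).toEquiv) ▸
      Subgroup.card_subgroup_dvd_card _
  exact (Subgroup.index_dvd_of_le hq).trans this
end

section
/- Let K/F be a quadratic extension of number fields with Galois group G and S-units as above. Then h(G, U_{K,S}) = (1/2) ∏_{v ∈ S_F} n_v, where n_v is the order of the decomposition group in G of a prime of K above v. -/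
open NumberField IsDedekindDomain

variable (F K : Type*) [Field F] [NumberField F] [Field K] [NumberField K]
  [Algebra F K] [IsGalois F K]

/-- The order of the decomposition group of a finite prime `w` of `K` in `Gal(K/F)`. -/
noncomputable def decOrderFin (w : HeightOneSpectrum (𝓞 K)) : ℕ :=
  Nat.card {τ : K ≃ₐ[F] K //
    w.asIdeal.comap ((galRestrict (𝓞 F) F K (𝓞 K) τ : 𝓞 K ≃ₐ[𝓞 F] 𝓞 K) : 𝓞 K →+* 𝓞 K) =
      w.asIdeal}

/-- The order of the decomposition group of an infinite place `w` of `K` in `Gal(K/F)`. -/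
noncomputable def decOrderInf (w : InfinitePlace K) : ℕ :=
  Nat.card {τ : K ≃ₐ[F] K // w.comap τ.toAlgHom.toRingHom = w}

theorem MonoidHom.finrank_range_add_finrank_ker_int {G H : Type*} [CommGroup G] [CommGroup H]
    [Module.Finite ℤ (Additive G)] (f : G →* H) :
    Module.finrank ℤ (Additive f.range) + Module.finrank ℤ (Additive f.ker) =
      Module.finrank ℤ (Additive G) := by
  let g := (MonoidHom.toAdditive f).toIntLinearMap
  rw [← (LinearMap.ker g).finrank_quotient_add_finrank, g.quotKerEquivRange.finrank_eq]
  rfl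

theorem Subgroup.module_finite_int {G : Type*} [CommGroup G] [Module.Finite ℤ (Additive G)]
    (H : Subgroup G) : Module.Finite ℤ (Additive H) :=
  inferInstanceAs (Module.Finite ℤ (AddSubgroup.toIntSubmodule (Subgroup.toAddSubgroup H)))

theorem Subgroup.finrank_eq_of_pow_mem {G : Type*} [CommGroup G] [Module.Finite ℤ (Additive G)]
    {H : Subgroup G} {n : ℕ} (hn : n ≠ 0) (h : ∀ x : G, x ^ n ∈ H) :
    Module.finrank ℤ (Additive H) = Module.finrank ℤ (Additive G) := by
  let N : Submodule ℤ (Additive G) := AddSubgroup.toIntSubmodule (Subgroup.toAddSubgroup H)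
  have htor : Module.IsTorsion ℤ (Additive G ⧸ N) := by
    intro x
    obtain ⟨x, rfl⟩ := Submodule.Quotient.mk_surjective _ x
    refine ⟨⟨(n : ℤ), mem_nonZeroDivisors_of_ne_zero (by exact_mod_cast hn)⟩, ?_⟩
    change (n : ℤ) • (Submodule.Quotient.mk x : Additive G ⧸ N) = 0
    rw [← Submodule.Quotient.mk_smul, Submodule.Quotient.mk_eq_zero, natCast_zsmul]
    exact h x.toMul
  have := N.finrank_quotient_add_finrank
  rw [htor.finrank_eq_zero, zero_add] at this
  exact this

theorem Subgroup.index_range_powMonoidHom_pi_int {ι : Type*} [Fintype ι] (n : ℕ) :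
    (powMonoidHom (α := ι → Multiplicative ℤ) n).range.index = n ^ Fintype.card ι := by
  have : (powMonoidHom (α := ι → Multiplicative ℤ) n).range =
      Subgroup.pi Set.univ fun _ => (powMonoidHom (α := Multiplicative ℤ) n).range := by
    ext x
    simp only [MonoidHom.mem_range, powMonoidHom_apply, Subgroup.mem_pi, Set.mem_univ,
      true_implies, funext_iff, Pi.pow_apply]
    exact ⟨fun ⟨y, hy⟩ i => ⟨y i, hy i⟩,
      fun h => ⟨fun i => (h i).choose, fun i => (h i).choose_spec⟩⟩
  rw [this, Subgroup.index_pi]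
  have h1 : (powMonoidHom (α := Multiplicative ℤ) n).range.index = n := by
    have : (powMonoidHom (α := Multiplicative ℤ) n).range =
        AddSubgroup.toSubgroup (AddSubgroup.zmultiples (n : ℤ)) := by
      ext x
      simp only [MonoidHom.mem_range, powMonoidHom_apply]
      constructor
      · rintro ⟨y, rfl⟩
        exact ⟨y.toAdd, by simp; ring⟩
      · rintro ⟨k, hk⟩
        refine ⟨Multiplicative.ofAdd k, ?_⟩
        apply Multiplicative.toAdd.injective
        simp at hk ⊢
        linarith
    rw [this, AddSubgroup.index_toSubgroup, Int.index_zmultiples, Int.natAbs_natCast]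
  simp [h1]

theorem Group.finrank_eq_card_of_mulEquiv {G T j : Type*} [CommGroup G]
    [Module.Finite ℤ (Additive G)] [CommGroup T] [Finite T] [Fintype j]
    (f : G ≃* (j → Multiplicative ℤ) × T) :
    Module.finrank ℤ (Additive G) = Fintype.card j := by
  let g : G →* (j → Multiplicative ℤ) := (MonoidHom.fst _ _).comp f.toMonoidHom
  have hg : g.range = ⊤ := MonoidHom.range_eq_top.2 (Prod.fst_surjective.comp f.surjective)
  have htor : Module.IsTorsion ℤ (Additive g.ker) := by
    intro x
    refine ⟨⟨(Nat.card T : ℤ), mem_nonZeroDivisors_of_ne_zero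
      (by exact_mod_cast Nat.card_pos.ne')⟩, ?_⟩
    change (Nat.card T : ℤ) • x = 0
    rw [natCast_zsmul]
    have hx : (f x.toMul.1).1 = 1 := x.toMul.2
    apply Additive.toMul.injective
    apply Subtype.ext
    apply f.injective
    ext1 <;> simp [hx]
  have h := g.finrank_range_add_finrank_ker_int
  rw [htor.finrank_eq_zero, add_zero, hg] at h
  rw [← h]
  have h2 : Module.finrank ℤ (Additive (⊤ : Subgroup (j → Multiplicative ℤ))) =
      Module.finrank ℤ (j → ℤ) :=
    finrank_top ℤ (j → ℤ)
  rw [h2, Module.finrank_fintype_fun_eq_card]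

theorem Group.index_range_powMonoidHom_of_mulEquiv {G T j : Type*} [CommGroup G]
    [CommGroup T] [Finite T] [Fintype j] (f : G ≃* (j → Multiplicative ℤ) × T)
    {n : ℕ} (hn : n ≠ 0) :
    (powMonoidHom (α := G) n).range.index =
      n ^ Fintype.card j * Nat.card (powMonoidHom (α := G) n).ker := by
  have hrange : (powMonoidHom (α := G) n).range =
      ((powMonoidHom (α := j → Multiplicative ℤ) n).range.prod
        (powMonoidHom (α := T) n).range).comap f.toMonoidHom := by
    ext x
    simp only [MonoidHom.mem_range, powMonoidHom_apply, Subgroup.mem_comap, Subgroup.mem_prod]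
    constructor
    · rintro ⟨y, rfl⟩
      exact ⟨⟨(f y).1, by simp⟩, ⟨(f y).2, by simp⟩⟩
    · rintro ⟨⟨a, ha⟩, ⟨b, hb⟩⟩
      refine ⟨f.symm (a, b), f.injective ?_⟩
      ext1 <;> simp [ha, hb]
  rw [hrange, Subgroup.index_comap_of_surjective _ f.surjective, Subgroup.index_prod,
    Subgroup.index_range_powMonoidHom_pi_int, Subgroup.index_range]
  congr 1
  refine Nat.card_congr ⟨fun t => ⟨f.symm (1, t.1), ?_⟩, fun x => ⟨(f x.1).2, ?_⟩, ?_, ?_⟩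
  · have := t.2
    rw [MonoidHom.mem_ker, powMonoidHom_apply] at this ⊢
    rw [← map_pow, Prod.pow_mk, this, one_pow, ← Prod.one_eq_mk, map_one]
  · have := x.2
    rw [MonoidHom.mem_ker, powMonoidHom_apply] at this ⊢
    rw [← Prod.pow_snd, ← map_pow, this, map_one, Prod.snd_one]
  · intro t
    simp
  · intro x
    have hx := x.2
    rw [MonoidHom.mem_ker, powMonoidHom_apply] at hx
    have h1 : (f x.1).1 = 1 := by
      have : (f x.1).1 ^ n = 1 := by rw [← Prod.pow_fst, ← map_pow, hx, map_one, Prod.fst_one]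
      ext i
      have := congrArg Multiplicative.toAdd (congrFun this i)
      simpa [hn] using this
    apply Subtype.ext
    apply f.injective
    ext1 <;> simp [h1]

theorem Group.index_range_powMonoidHom {G : Type*} [CommGroup G] [Module.Finite ℤ (Additive G)]
    {n : ℕ} (hn : n ≠ 0) :
    (powMonoidHom (α := G) n).range.index =
      n ^ Module.finrank ℤ (Additive G) * Nat.card (powMonoidHom (α := G) n).ker := by
  have : Group.FG G := by
    rw [GroupFG.iff_add_fg, ← Module.Finite.iff_addGroup_fg]
    infer_instance
  obtain ⟨ι, j, _, _, p, hp, e, ⟨f⟩⟩ := CommGroup.equiv_free_prod_prod_multiplicative_zmod G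
  have (i : ι) : NeZero (p i ^ e i) := ⟨pow_ne_zero _ (hp i).ne_zero⟩
  rw [Group.finrank_eq_card_of_mulEquiv f, Group.index_range_powMonoidHom_of_mulEquiv f hn]

section Involution

variable {M : Type*} [CommGroup M] [Module.Finite ℤ (Additive M)] {s : M →* M}

theorem MonoidHom.index_herbrand_aux (f g : M →* M) (hfg : ∀ x, g (f x) = 1)
    (hf : ∀ x ∈ g.ker, f x = x ^ 2) :
    f.range.relIndex g.ker * (g.ker ⊔ f.ker).index =
      2 ^ Module.finrank ℤ (Additive g.ker) * Nat.card (powMonoidHom (α := g.ker) 2).ker := by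
  have := g.ker.module_finite_int
  have hle : f.range ≤ g.ker := by
    rintro _ ⟨x, rfl⟩
    exact hfg x
  have hmap : (powMonoidHom (α := g.ker) 2).range = (g.ker.map f).subgroupOf g.ker := by
    ext x
    simp only [MonoidHom.mem_range, powMonoidHom_apply, Subgroup.mem_subgroupOf,
      Subgroup.mem_map]
    constructor
    · rintro ⟨y, rfl⟩
      exact ⟨y, y.2, by simp [hf y y.2]⟩
    · rintro ⟨y, hy, hxy⟩
      exact ⟨⟨y, hy⟩, Subtype.ext (by rw [← hxy, hf y hy]; rfl)⟩
  rw [← Group.index_range_powMonoidHom two_ne_zero, hmap, ← Subgroup.relIndex,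
    ← Subgroup.relIndex_mul_relIndex _ f.range _ (Subgroup.map_le_range _ _) hle, mul_comm]
  congr 1
  rw [MonoidHom.range_eq_map, Subgroup.relIndex_map_map, top_sup_eq, Subgroup.relIndex_top_right]

/-- The Herbrand quotient of a finitely generated abelian group with an involution `s` is
`2 ^ (rank M⁺ - rank M⁻)`. -/
theorem MonoidHom.herbrand_involution (hs : ∀ x, s (s x) = x) :
    (((MonoidHom.id M * s).range.relIndex (MonoidHom.id M / s).ker : ℕ) : ℚ) /
      ((MonoidHom.id M / s).range.relIndex (MonoidHom.id M * s).ker : ℕ) =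
    2 ^ Module.finrank ℤ (Additive (MonoidHom.id M / s).ker) /
      2 ^ Module.finrank ℤ (Additive (MonoidHom.id M * s).ker) := by
  set N := MonoidHom.id M * s with hN
  set D := MonoidHom.id M / s with hD
  have hNa (x) : N x = x * s x := rfl
  have hDa (x) : D x = x / s x := rfl
  have h1 := MonoidHom.index_herbrand_aux N D (fun x => by simp [hNa, hDa, hs, mul_comm])
    (fun x hx => by
      rw [MonoidHom.mem_ker, hDa, div_eq_one] at hx
      rw [hNa, ← hx, sq])
  have h2 := MonoidHom.index_herbrand_aux D N (fun x => by simp [hNa, hDa, hs])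
    (fun x hx => by
      rw [MonoidHom.mem_ker, hNa, mul_eq_one_iff_inv_eq] at hx
      rw [hDa, ← hx, div_inv_eq_mul, sq])
  have hc : Nat.card (powMonoidHom (α := D.ker) 2).ker =
      Nat.card (powMonoidHom (α := N.ker) 2).ker := by
    have key (x : M) (hx : x ^ 2 = 1) : x ∈ D.ker ↔ x ∈ N.ker := by
      have : x⁻¹ = x := by rw [inv_eq_iff_mul_eq_one, ← sq, hx]
      rw [MonoidHom.mem_ker, MonoidHom.mem_ker, hNa, hDa, div_eq_one, mul_eq_one_iff_inv_eq, this]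
    have sqone {H : Subgroup M} (x : (powMonoidHom (α := H) 2).ker) : (x : M) ^ 2 = 1 :=
      congrArg Subtype.val (MonoidHom.mem_ker.1 x.2)
    exact Nat.card_congr
      ⟨fun x => ⟨⟨x, (key _ (sqone x)).1 x.1.2⟩, Subtype.ext (sqone x)⟩,
        fun x => ⟨⟨x, (key _ (sqone x)).2 x.1.2⟩, Subtype.ext (sqone x)⟩,
        fun _ => rfl, fun _ => rfl⟩
  have hpos {H : Subgroup M} : Nat.card (powMonoidHom (α := H) 2).ker ≠ 0 := by
    have := H.module_finite_int
    have : Group.FG H := by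
      rw [GroupFG.iff_add_fg, ← Module.Finite.iff_addGroup_fg]
      infer_instance
    intro h0
    have := Group.index_range_powMonoidHom (G := H) two_ne_zero
    rw [h0, mul_zero] at this
    exact (Subgroup.finiteIndex_range_powMonoidHom_of_fg H two_ne_zero).index_ne_zero this
  rw [sup_comm] at h2
  rw [hc] at h1
  have hc0 := hpos (H := N.ker)
  have hi : (D.ker ⊔ N.ker).index ≠ 0 := by
    intro h0
    rw [h0, mul_zero] at h1
    exact mul_ne_zero (by positivity) hc0 h1.symm
  have hr : D.range.relIndex N.ker ≠ 0 := by
    intro h0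
    rw [h0, zero_mul] at h2
    exact mul_ne_zero (by positivity) hc0 h2.symm
  rw [div_eq_div_iff (by exact_mod_cast hr) (by positivity)]
  norm_cast
  apply mul_right_cancel₀ (mul_ne_zero hi hc0)
  linear_combination
    (2 ^ Module.finrank ℤ (Additive N.ker)) * Nat.card (powMonoidHom (α := N.ker) 2).ker * h1 -
      (2 ^ Module.finrank ℤ (Additive D.ker)) * Nat.card (powMonoidHom (α := N.ker) 2).ker * h2

theorem MonoidHom.finrank_ker_add_finrank_ker_involution (hs : ∀ x, s (s x) = x) :
    Module.finrank ℤ (Additive (MonoidHom.id M / s).ker) +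
      Module.finrank ℤ (Additive (MonoidHom.id M * s).ker) = Module.finrank ℤ (Additive M) := by
  rw [← (MonoidHom.id M * s).finrank_range_add_finrank_ker_int]
  congr 1
  have hle : (MonoidHom.id M * s).range ≤ (MonoidHom.id M / s).ker := by
    rintro _ ⟨x, rfl⟩
    simp [MonoidHom.mem_ker, hs, mul_comm]
  have := (MonoidHom.id M / s).ker.module_finite_int
  rw [← Subgroup.finrank_eq_of_pow_mem two_ne_zero
    (H := (MonoidHom.id M * s).range.subgroupOf (MonoidHom.id M / s).ker)]
  · exact (MulEquiv.toAdditive (Subgroup.subgroupOfEquivOfLe hle)).toIntLinearEquiv.finrank_eq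
  · intro x
    have hx := x.2
    rw [MonoidHom.mem_ker, MonoidHom.div_apply, MonoidHom.id_apply, div_eq_one] at hx
    exact ⟨x, by rw [MonoidHom.mul_apply, MonoidHom.id_apply, ← hx]; simp [sq]⟩

end Involution

section SUnitRank

variable {L : Type*} [Field L] [NumberField L]

/-- The tuple of valuations of an `S`-unit at the primes of `S`. -/
noncomputable def Set.unitValuation (S : Set (HeightOneSpectrum (𝓞 L))) :
    S.unit L →* (S → Multiplicative ℤ) :=
  MonoidHom.pi fun v => v.1.valuationOfNeZero.comp (S.unit L).subtype

/-- The inclusion of the units of the ring of integers into the `S`-units. -/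
noncomputable def Set.unitsToUnit (S : Set (HeightOneSpectrum (𝓞 L))) :
    (𝓞 L)ˣ →* S.unit L :=
  (Units.map (algebraMap (𝓞 L) L : 𝓞 L →* L)).codRestrict (S.unit L) fun x v _ => by
    rw [← HeightOneSpectrum.valuationOfNeZero_eq]
    exact_mod_cast v.valuation_of_unit_eq (K := L) x

theorem Set.unitsToUnit_injective (S : Set (HeightOneSpectrum (𝓞 L))) :
    Function.Injective S.unitsToUnit := fun _ _ h =>
  Units.map_injective (FaithfulSMul.algebraMap_injective (𝓞 L) L) (congrArg Subtype.val h)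

theorem Set.range_unitsToUnit (S : Set (HeightOneSpectrum (𝓞 L))) :
    S.unitsToUnit.range = S.unitValuation.ker := by
  ext x
  constructor
  · rintro ⟨u, rfl⟩
    rw [MonoidHom.mem_ker]
    ext v
    exact congrArg Multiplicative.toAdd (v.1.valuation_of_unit_eq (K := L) u)
  · intro hx
    have hv (v : HeightOneSpectrum (𝓞 L)) : v.valuation L (x : Lˣ) = 1 := by
      by_cases h : v ∈ S
      · rw [← HeightOneSpectrum.valuationOfNeZero_eq]
        exact congrArg _ (congrFun (MonoidHom.mem_ker.1 hx) ⟨v, h⟩)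
      · exact x.2 v h
    obtain ⟨a, ha⟩ := HeightOneSpectrum.mem_integers_of_valuation_le_one L (R := 𝓞 L) (x : Lˣ)
      fun v => (hv v).le
    obtain ⟨b, hb⟩ := HeightOneSpectrum.mem_integers_of_valuation_le_one L (R := 𝓞 L)
      ((x⁻¹ : Lˣ) : L) fun v => by
        rw [Units.val_inv_eq_inv_val, map_inv₀, hv, inv_one]
    have hab : a * b = 1 := FaithfulSMul.algebraMap_injective (𝓞 L) L (by simp [ha, hb])
    exact ⟨⟨a, b, hab, by rw [mul_comm, hab]⟩, Subtype.ext (Units.ext ha)⟩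

theorem IsDedekindDomain.HeightOneSpectrum.exists_valuation_eq_exp_neg_card_classGroup
    (v : HeightOneSpectrum (𝓞 L)) :
    ∃ u : Lˣ, v.valuation L u = WithZero.exp (-(Nat.card (ClassGroup (𝓞 L)) : ℤ)) ∧
      ∀ w : HeightOneSpectrum (𝓞 L), w ≠ v → w.valuation L u = 1 := by
  set h := Nat.card (ClassGroup (𝓞 L))
  have hv : v.asIdeal ∈ nonZeroDivisors (Ideal (𝓞 L)) := mem_nonZeroDivisors_of_ne_zero v.ne_bot
  have h1 : ClassGroup.mk0 (⟨v.asIdeal, hv⟩ ^ h) = 1 := by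
    rw [map_pow, pow_card_eq_one']
  rw [SubmonoidClass.mk_pow, ClassGroup.mk0_eq_one_iff] at h1
  obtain ⟨a, ha⟩ := h1
  change v.asIdeal ^ h = Ideal.span {a} at ha
  have ha0 : a ≠ 0 := by
    rintro rfl
    rw [Ideal.span_singleton_eq_bot.2 rfl] at ha
    exact pow_ne_zero h v.ne_bot ha
  refine ⟨Units.mk0 (algebraMap (𝓞 L) L a) (by simpa using ha0), ?_, fun w hw => ?_⟩
  · rw [Units.val_mk0, HeightOneSpectrum.valuation_of_algebraMap,
      HeightOneSpectrum.intValuation_eq_exp_neg_multiplicity _ ha0, ← ha,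
      multiplicity_pow_self v.ne_bot v.prime.not_isUnit]
  · rw [Units.val_mk0, HeightOneSpectrum.valuation_eq_one_iff_notMem]
    intro haw
    have hle : v.asIdeal ^ h ≤ w.asIdeal := by
      rw [ha, Ideal.span_singleton_le_iff_mem]
      exact haw
    exact hw (HeightOneSpectrum.ext (v.isMaximal.eq_of_le w.isPrime.ne_top
      (w.isPrime.le_of_pow_le hle)).symm)

theorem Set.pow_mem_range_unitValuation (S : Set (HeightOneSpectrum (𝓞 L))) [Finite S]
    (x : S → Multiplicative ℤ) :
    x ^ Nat.card (ClassGroup (𝓞 L)) ∈ S.unitValuation.range := by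
  classical
  have := Fintype.ofFinite S
  rw [← Finset.univ_prod_mulSingle (x ^ _)]
  refine Subgroup.prod_mem _ fun v _ => ?_
  obtain ⟨u, hu, hu'⟩ := v.1.exists_valuation_eq_exp_neg_card_classGroup
  refine ⟨⟨u, fun w hw => hu' w fun h => hw (h ▸ v.2)⟩ ^ (-(x v).toAdd), ?_⟩
  have hval : S.unitValuation ⟨u, fun w hw => hu' w fun h => hw (h ▸ v.2)⟩ =
      Pi.mulSingle v (Multiplicative.ofAdd (-(Nat.card (ClassGroup (𝓞 L)) : ℤ))) := by
    funext w
    apply WithZero.coe_injective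
    by_cases hwv : w = v
    · subst hwv
      rw [Pi.mulSingle_eq_same]
      exact (w.1.valuationOfNeZero_eq u).trans hu
    · rw [Pi.mulSingle_eq_of_ne hwv]
      exact (w.1.valuationOfNeZero_eq u).trans (hu' _ fun h => hwv (Subtype.ext h))
  rw [map_zpow, hval, ← Pi.mulSingle_zpow]
  congr 1
  apply Multiplicative.toAdd.injective
  simp [mul_comm]

instance Set.moduleFinite_unit (S : Set (HeightOneSpectrum (𝓞 L))) [Finite S] :
    Module.Finite ℤ (Additive (S.unit L)) := by
  let g := (MonoidHom.toAdditive S.unitValuation).toIntLinearMap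
  let f := (MonoidHom.toAdditive S.unitsToUnit).toIntLinearMap
  have hker : LinearMap.range f = LinearMap.ker g := by
    ext x
    exact SetLike.ext_iff.1 S.range_unitsToUnit x.toMul
  have h1 : Module.Finite ℤ (LinearMap.ker g) := by
    rw [← hker]
    infer_instance
  have : Module.Finite ℤ (Additive (S → Multiplicative ℤ)) :=
    inferInstanceAs (Module.Finite ℤ (S → ℤ))
  have h2 : Module.Finite ℤ (Additive (S.unit L) ⧸ LinearMap.ker g) :=
    Module.Finite.equiv g.quotKerEquivRange.symm
  exact Module.Finite.of_submodule_quotient (LinearMap.ker g)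

/-- Dirichlet's `S`-unit theorem: the rank of the group of `S`-units. -/
theorem Set.finrank_unit (S : Set (HeightOneSpectrum (𝓞 L))) [Finite S] :
    Module.finrank ℤ (Additive (S.unit L)) = Units.rank L + Nat.card S := by
  have : Module.Finite ℤ (Additive (S → Multiplicative ℤ)) :=
    inferInstanceAs (Module.Finite ℤ (S → ℤ))
  have := Fintype.ofFinite S
  rw [← S.unitValuation.finrank_range_add_finrank_ker_int,
    Subgroup.finrank_eq_of_pow_mem Nat.card_pos.ne' S.pow_mem_range_unitValuation,
    ← S.range_unitsToUnit, ← Units.finrank_eq, add_comm]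
  congr 1
  · exact (MulEquiv.toAdditive
      (MonoidHom.ofInjective S.unitsToUnit_injective)).symm.toIntLinearEquiv.finrank_eq
  · rw [Nat.card_eq_fintype_card, ← Module.finrank_fintype_fun_eq_card (R := ℤ)]
    rfl

end SUnitRank

section Fibers

variable {X Y : Type*} [Fintype Y] {f : X → Y} {s t : Y → X}

open Classical in
theorem natCard_add_sum_ite_eq_two_mul_card [Finite X]
    (h : ∀ x y, f x = y ↔ x = s y ∨ x = t y) :
    Nat.card X + ∑ y, (if t y = s y then 1 else 0) = 2 * Fintype.card Y := by
  have := Fintype.ofFinite X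
  rw [Nat.card_congr (Equiv.sigmaFiberEquiv f).symm, Nat.card_sigma, ← Finset.sum_add_distrib,
    mul_comm, ← smul_eq_mul, ← Finset.card_univ, ← Finset.sum_const]
  refine Finset.sum_congr rfl fun y _ => ?_
  have hfib : {x | f x = y} = {s y, t y} := by
    ext x
    exact h x y
  change Nat.card {x | f x = y} + _ = 2
  rw [Nat.card_coe_set_eq, hfib]
  split_ifs with hy
  · simp [hy]
  · rw [Set.ncard_pair (Ne.symm hy)]

end Fibers

section Quadratic

variable {F K}

/-- The conjugate of a finite prime of `K` by an element of the Galois group. -/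
noncomputable def conjPrime (τ : K ≃ₐ[F] K) (w : HeightOneSpectrum (𝓞 K)) :
    HeightOneSpectrum (𝓞 K) where
  asIdeal := w.asIdeal.comap
    ((galRestrict (𝓞 F) F K (𝓞 K) τ : 𝓞 K ≃ₐ[𝓞 F] 𝓞 K) : 𝓞 K →+* 𝓞 K)
  isPrime := w.isPrime.comap _
  ne_bot h := w.ne_bot <| by
    rw [eq_bot_iff]
    intro x hx
    obtain ⟨y, rfl⟩ := (galRestrict (𝓞 F) F K (𝓞 K) τ).surjective x
    have hy : y ∈ (⊥ : Ideal (𝓞 K)) := h ▸ hx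
    rw [Ideal.mem_bot] at hy ⊢
    rw [hy, map_zero]

theorem mem_conjPrime {τ : K ≃ₐ[F] K} {w : HeightOneSpectrum (𝓞 K)} {x : 𝓞 K} :
    x ∈ (conjPrime τ w).asIdeal ↔ galRestrict (𝓞 F) F K (𝓞 K) τ x ∈ w.asIdeal :=
  Iff.rfl

theorem comap_conjPrime (τ : K ≃ₐ[F] K) (w : HeightOneSpectrum (𝓞 K)) :
    (conjPrime τ w).asIdeal.comap (algebraMap (𝓞 F) (𝓞 K)) =
      w.asIdeal.comap (algebraMap (𝓞 F) (𝓞 K)) := by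
  ext x
  rw [Ideal.mem_comap, mem_conjPrime, AlgEquiv.commutes, Ideal.mem_comap]

theorem valuation_apply_le_one (τ : K ≃ₐ[F] K) {w : HeightOneSpectrum (𝓞 K)} {x : K}
    (hx : (conjPrime τ w).valuation K x ≤ 1) : w.valuation K (τ x) ≤ 1 := by
  obtain ⟨n, d, hd⟩ := (conjPrime τ w).exists_primeCompl_mul_eq_of_integer x hx
  have h := congrArg (fun y => w.valuation K (τ y)) hd
  simp only [map_mul, ← algebraMap_galRestrict_apply (𝓞 F)] at h
  have hd1 : w.valuation K (algebraMap (𝓞 K) K (galRestrict (𝓞 F) F K (𝓞 K) τ d)) = 1 :=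
    w.valuation_eq_one_iff_notMem.2 d.2
  rw [hd1, mul_one] at h
  rw [h]
  exact w.valuation_le_one _

theorem sigmaU_mem_UKS (τ : K ≃ₐ[F] K) {SF : Finset (HeightOneSpectrum (𝓞 F))} {u : Kˣ}
    (hu : u ∈ UKS F K SF) : sigmaU F K τ u ∈ UKS F K SF := by
  intro w hw
  have hval {x : Kˣ} (hx : x ∈ UKS F K SF) : w.valuation K (τ x) ≤ 1 := by
    refine valuation_apply_le_one τ (hx _ ?_).le
    rintro ⟨v, hv, h⟩
    exact hw ⟨v, hv, by rw [← h, comap_conjPrime]⟩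
  refine le_antisymm (hval hu) ?_
  have := hval (inv_mem hu)
  rw [Units.val_inv_eq_inv_val, map_inv₀, map_inv₀] at this
  exact (inv_le_one₀ (zero_lt_iff.2 ((Valuation.ne_zero_iff _).2 (by simp)))).1 this

/-- The Galois action on the `S`-units of `K`. -/
noncomputable def sigmaUKS (τ : K ≃ₐ[F] K) (SF : Finset (HeightOneSpectrum (𝓞 F))) :
    UKS F K SF →* UKS F K SF :=
  ((sigmaU F K τ).comp (UKS F K SF).subtype).codRestrict _ fun u => sigmaU_mem_UKS τ u.2

theorem mem_SKset_iff {SF : Finset (HeightOneSpectrum (𝓞 F))} {v : HeightOneSpectrum (𝓞 F)}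
    {w : HeightOneSpectrum (𝓞 K)}
    (h : w.asIdeal.comap (algebraMap (𝓞 F) (𝓞 K)) = v.asIdeal) : w ∈ SKset F K SF ↔ v ∈ SF :=
  ⟨fun ⟨_, hv', h'⟩ => HeightOneSpectrum.ext (h.symm.trans h') ▸ hv', fun hv => ⟨v, hv, h⟩⟩

theorem exists_comap_asIdeal_eq (v : HeightOneSpectrum (𝓞 F)) :
    ∃ w : HeightOneSpectrum (𝓞 K),
      w.asIdeal.comap (algebraMap (𝓞 F) (𝓞 K)) = v.asIdeal := by
  obtain ⟨Q, hQ, hQv⟩ := (Ideal.nonempty_primesOver (S := 𝓞 K) v.asIdeal).some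
  exact ⟨⟨Q, hQ, Ideal.ne_bot_of_liesOver_of_ne_bot v.ne_bot Q⟩, hQv.over.symm⟩

theorem valuation_algebraMap_eq_one_iff {v : HeightOneSpectrum (𝓞 F)}
    {w : HeightOneSpectrum (𝓞 K)}
    (h : w.asIdeal.comap (algebraMap (𝓞 F) (𝓞 K)) = v.asIdeal) (x : F) :
    w.valuation K (algebraMap F K x) = 1 ↔ v.valuation F x = 1 := by
  have : w.asIdeal.LiesOver v.asIdeal := ⟨h.symm⟩
  rw [← HeightOneSpectrum.valuation_liesOver K v w, pow_eq_one_iff_of_nonneg zero_le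
    (Ideal.IsDedekindDomain.ramificationIdx'_ne_zero_of_liesOver w.asIdeal v.ne_bot)]

theorem algebraMap_mem_UKS_iff {SF : Finset (HeightOneSpectrum (𝓞 F))} {x : Fˣ} :
    Units.map (algebraMap F K : F →* K) x ∈ UKS F K SF ↔
      x ∈ (SF : Set (HeightOneSpectrum (𝓞 F))).unit F := by
  constructor
  · intro hx v hv
    obtain ⟨w, hw⟩ := exists_comap_asIdeal_eq (K := K) v
    exact (valuation_algebraMap_eq_one_iff hw _).1 (hx w fun h => hv ((mem_SKset_iff hw).1 h))
  · intro hx w hw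
    have hv : w.asIdeal.comap (algebraMap (𝓞 F) (𝓞 K)) = (w.under (𝓞 F)).asIdeal := rfl
    exact (valuation_algebraMap_eq_one_iff hv _).2 (hx _ fun h => hw ((mem_SKset_iff hv).2 h))

theorem map_unit_eq_UFS (SF : Finset (HeightOneSpectrum (𝓞 F))) :
    ((SF : Set (HeightOneSpectrum (𝓞 F))).unit F).map
      (Units.map (algebraMap F K : F →* K)) = UFS F K SF := by
  ext u
  constructor
  · rintro ⟨x, hx, rfl⟩
    exact ⟨algebraMap_mem_UKS_iff.2 hx, fun τ => Units.ext (τ.commutes x)⟩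
  · rintro ⟨hu, hfix⟩
    obtain ⟨x, hx⟩ := (IsGalois.mem_range_algebraMap_iff_fixed (F := F) (u : K)).2
      fun τ => congrArg Units.val (hfix τ)
    have hx0 : x ≠ 0 := by
      rintro rfl
      exact u.ne_zero (by rw [← hx, map_zero])
    have hxu : Units.map (algebraMap F K : F →* K) (Units.mk0 x hx0) = u := Units.ext hx
    exact ⟨Units.mk0 x hx0, algebraMap_mem_UKS_iff.1 (hxu ▸ hu), hxu⟩

theorem finrank_UFS (SF : Finset (HeightOneSpectrum (𝓞 F))) :
    Module.finrank ℤ (Additive (UFS F K SF)) = Units.rank F + SF.card := by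
  rw [← map_unit_eq_UFS]
  have e := Subgroup.equivMapOfInjective ((SF : Set (HeightOneSpectrum (𝓞 F))).unit F)
    (Units.map (algebraMap F K : F →* K)) (Units.map_injective (algebraMap F K).injective)
  rw [← (MulEquiv.toAdditive e).toIntLinearEquiv.finrank_eq, Set.finrank_unit]
  simp

theorem SKset_finite (SF : Finset (HeightOneSpectrum (𝓞 F))) : (SKset F K SF).Finite := by
  have hsub : SKset F K SF ⊆ ⋃ v ∈ SF,
      HeightOneSpectrum.asIdeal ⁻¹' (v.asIdeal.primesOver (𝓞 K)) := by
    rintro w ⟨v, hv, h⟩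
    exact Set.mem_biUnion hv ⟨w.isPrime, ⟨h.symm⟩⟩
  refine Set.Finite.subset (SF.finite_toSet.biUnion fun v _ => ?_) hsub
  exact (IsDedekindDomain.primesOver_finite v.asIdeal (𝓞 K)).preimage
    fun _ _ _ _ h => HeightOneSpectrum.ext h

theorem eq_one_or_eq_of_finrank_eq_two (hd : Module.finrank F K = 2) {σ : K ≃ₐ[F] K}
    (hσ : σ ≠ 1) (τ : K ≃ₐ[F] K) : τ = 1 ∨ τ = σ := by
  have hcard : Nat.card (K ≃ₐ[F] K) = 2 := by rw [IsGalois.card_aut_eq_finrank, hd]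
  obtain ⟨x, y, hxy, h⟩ := Nat.card_eq_two_iff.1 hcard
  have h1 (z : K ≃ₐ[F] K) : z = x ∨ z = y := h.ge (Set.mem_univ z)
  rcases h1 1 with h2 | h2 <;> rcases h1 σ with h3 | h3 <;> rcases h1 τ with h4 | h4 <;> simp_all

theorem apply_apply_of_finrank_eq_two (hd : Module.finrank F K = 2) (σ : K ≃ₐ[F] K) (x : K) :
    σ (σ x) = x := by
  have hcard : Nat.card (K ≃ₐ[F] K) = 2 := by rw [IsGalois.card_aut_eq_finrank, hd]
  have : σ ^ 2 = 1 := by rw [← hcard, pow_card_eq_one']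
  rw [sq] at this
  exact DFunLike.congr_fun this x

open Classical in
theorem natCard_subtype_gal (hd : Module.finrank F K = 2) {σ : K ≃ₐ[F] K} (hσ : σ ≠ 1)
    (P : (K ≃ₐ[F] K) → Prop) (h1 : P 1) :
    Nat.card {τ // P τ} = 2 ^ (if P σ then 1 else 0) := by
  have h := eq_one_or_eq_of_finrank_eq_two hd hσ
  split_ifs with hP
  · have : {τ | P τ} = {1, σ} := by
      ext τ
      constructor
      · exact fun _ => h τ
      · rintro (rfl | rfl) <;> assumption
    change Nat.card {τ | P τ} = _
    rw [Nat.card_coe_set_eq, this, Set.ncard_pair hσ.symm, pow_one]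
  · have : {τ | P τ} = {1} := by
      ext τ
      constructor
      · intro hτ
        rcases h τ with rfl | rfl
        · rfl
        · exact absurd hτ hP
      · rintro rfl
        exact h1
    change Nat.card {τ | P τ} = _
    rw [Nat.card_coe_set_eq, this, Set.ncard_singleton, pow_zero]

theorem conjPrime_one (w : HeightOneSpectrum (𝓞 K)) : conjPrime (1 : K ≃ₐ[F] K) w = w := by
  ext x
  rw [mem_conjPrime, map_one, AlgEquiv.one_apply]

open Classical in
theorem decOrderFin_eq (hd : Module.finrank F K = 2) {σ : K ≃ₐ[F] K} (hσ : σ ≠ 1)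
    (w : HeightOneSpectrum (𝓞 K)) :
    decOrderFin F K w = 2 ^ (if conjPrime σ w = w then 1 else 0) := by
  rw [← natCard_subtype_gal hd hσ (fun τ => conjPrime τ w = w) (conjPrime_one w)]
  exact Nat.card_congr (Equiv.subtypeEquivRight fun τ =>
    ⟨fun h => HeightOneSpectrum.ext h, fun h => congrArg HeightOneSpectrum.asIdeal h⟩)

open Classical in
theorem decOrderInf_eq (hd : Module.finrank F K = 2) {σ : K ≃ₐ[F] K} (hσ : σ ≠ 1)
    (w : InfinitePlace K) :
    decOrderInf F K w = 2 ^ (if w.comap σ.toAlgHom.toRingHom = w then 1 else 0) :=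
  natCard_subtype_gal hd hσ (fun τ => w.comap τ.toAlgHom.toRingHom = w) rfl

open Classical in
theorem natCard_SKset_add_sum (hd : Module.finrank F K = 2) {σ : K ≃ₐ[F] K} (hσ : σ ≠ 1)
    (SF : Finset (HeightOneSpectrum (𝓞 F)))
    {wfin : HeightOneSpectrum (𝓞 F) → HeightOneSpectrum (𝓞 K)}
    (hwfin : ∀ v ∈ SF, (wfin v).asIdeal.comap (algebraMap (𝓞 F) (𝓞 K)) = v.asIdeal) :
    Nat.card (SKset F K SF) + ∑ v ∈ SF, (if conjPrime σ (wfin v) = wfin v then 1 else 0) =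
      2 * SF.card := by
  have := (SKset_finite (K := K) SF).to_subtype
  choose f hf hf' using fun w : SKset F K SF => w.2
  have h := natCard_add_sum_ite_eq_two_mul_card (X := SKset F K SF) (Y := SF)
    (f := fun w => ⟨f w, hf w⟩) (s := fun v => ⟨wfin v, v, v.2, hwfin v v.2⟩)
    (t := fun v => ⟨conjPrime σ (wfin v), v, v.2, by rw [comap_conjPrime, hwfin v v.2]⟩) <| by
    rintro w ⟨v, hv⟩
    simp only [Subtype.ext_iff]
    constructor
    · rintro rfl
      obtain ⟨τ, hτ⟩ := Ideal.exists_comap_galRestrict_eq (𝓞 F) F K (𝓞 K)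
        (p := (f w).asIdeal) (P₁ := (wfin (f w)).asIdeal) (P₂ := w.1.asIdeal)
        ⟨(wfin (f w)).isPrime, ⟨(hwfin _ hv).symm⟩⟩ ⟨w.1.isPrime, ⟨(hf' w).symm⟩⟩
      have hτ' : conjPrime τ (wfin (f w)) = w := HeightOneSpectrum.ext hτ
      rcases eq_one_or_eq_of_finrank_eq_two hd hσ τ with rfl | rfl
      · exact .inl (by rw [← hτ', conjPrime_one])
      · exact .inr hτ'.symm
    · intro h
      apply HeightOneSpectrum.ext
      rw [← hf' w]
      rcases h with h | h <;> rw [h]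
      · exact hwfin v hv
      · rw [comap_conjPrime, hwfin v hv]
  rw [Fintype.card_coe] at h
  rw [← h, ← Finset.sum_coe_sort SF]
  congr 1
  refine Finset.sum_congr rfl fun v _ => ?_
  by_cases hv : conjPrime σ (wfin v) = wfin v
  · rw [if_pos hv, if_pos (Subtype.ext hv)]
  · rw [if_neg hv, if_neg fun h => hv (congrArg Subtype.val h)]

open Classical in
theorem card_infinitePlace_add_sum (hd : Module.finrank F K = 2) {σ : K ≃ₐ[F] K} (hσ : σ ≠ 1)
    {winf : InfinitePlace F → InfinitePlace K}
    (hwinf : ∀ v : InfinitePlace F, (winf v).comap (algebraMap F K) = v) :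
    Fintype.card (InfinitePlace K) +
      ∑ v, (if (winf v).comap σ.toAlgHom.toRingHom = winf v then 1 else 0) =
      2 * Fintype.card (InfinitePlace F) := by
  rw [← Nat.card_eq_fintype_card (α := InfinitePlace K)]
  refine natCard_add_sum_ite_eq_two_mul_card
    (f := fun w : InfinitePlace K => w.comap (algebraMap F K)) fun w v => ?_
  constructor
  · intro h
    obtain ⟨τ, hτ⟩ := InfinitePlace.exists_smul_eq_of_comap_eq (w := winf v) (w' := w)
      (by rw [hwinf, h])
    have hτ' : (winf v).comap (τ⁻¹ : K ≃ₐ[F] K).toAlgHom.toRingHom = w := hτ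
    rcases eq_one_or_eq_of_finrank_eq_two hd hσ τ⁻¹ with h1 | h1 <;> rw [h1] at hτ'
    · exact .inl hτ'.symm
    · exact .inr hτ'.symm
  · rintro (rfl | rfl)
    · exact hwinf v
    · rw [← InfinitePlace.comap_comp]
      convert hwinf v
      exact σ.toAlgHom.comp_algebraMap

theorem herbrandU_eq_two_pow_div (hd : Module.finrank F K = 2) (σ : K ≃ₐ[F] K) (hσ : σ ≠ 1)
    (SF : Finset (HeightOneSpectrum (𝓞 F))) :
    ∃ a b : ℕ, herbrandU F K σ SF = 2 ^ a / 2 ^ b ∧ a = Units.rank F + SF.card ∧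
      a + b = Units.rank K + Nat.card (SKset F K SF) := by
  have := (SKset_finite (K := K) SF).to_subtype
  have : Module.Finite ℤ (Additive (UKS F K SF)) := Set.moduleFinite_unit (SKset F K SF)
  set s := sigmaUKS σ SF
  have hs (x) : s (s x) = x :=
    Subtype.ext (Units.ext (apply_apply_of_finrank_eq_two hd σ (x : Kˣ)))
  have hN : NUKS F K σ SF = (MonoidHom.id _ * s).range.map (UKS F K SF).subtype := by
    ext u
    constructor
    · rintro ⟨x, hx, rfl⟩
      exact ⟨_, ⟨⟨x, hx⟩, rfl⟩, rfl⟩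
    · rintro ⟨_, ⟨x, rfl⟩, rfl⟩
      exact ⟨x, x.2, rfl⟩
  have hD : (UKS F K SF).map (oneSubU F K σ) =
      (MonoidHom.id _ / s).range.map (UKS F K SF).subtype := by
    ext u
    constructor
    · rintro ⟨x, hx, rfl⟩
      exact ⟨_, ⟨⟨x, hx⟩, rfl⟩, rfl⟩
    · rintro ⟨_, ⟨x, rfl⟩, rfl⟩
      exact ⟨x, x.2, rfl⟩
  have hplus : UFS F K SF = (MonoidHom.id _ / s).ker.map (UKS F K SF).subtype := by
    ext u
    constructor
    · rintro ⟨hu, hfix⟩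
      exact ⟨⟨u, hu⟩, div_eq_one.2 (Subtype.ext (hfix σ).symm), rfl⟩
    · rintro ⟨u, hu, rfl⟩
      refine ⟨u.2, fun τ => ?_⟩
      rcases eq_one_or_eq_of_finrank_eq_two hd hσ τ with rfl | rfl
      · exact Units.ext rfl
      · exact (congrArg Subtype.val (div_eq_one.1 (MonoidHom.mem_ker.1 hu))).symm
  have hminus : UKSminus F K σ SF = (MonoidHom.id _ * s).ker.map (UKS F K SF).subtype := by
    ext u
    constructor
    · rintro ⟨hu, hfix⟩
      exact ⟨⟨u, hu⟩, Subtype.ext hfix, rfl⟩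
    · rintro ⟨u, hu, rfl⟩
      exact ⟨u.2, congrArg Subtype.val (MonoidHom.mem_ker.1 hu)⟩
  have hinj := (UKS F K SF).subtype_injective
  have hH0 : H0U F K σ SF = (NUKS F K σ SF).relIndex (UFS F K SF) := rfl
  have hH1 : H1U F K σ SF =
      ((UKS F K SF).map (oneSubU F K σ)).relIndex (UKSminus F K σ SF) := rfl
  refine ⟨_, _, ?_, ?_, (MonoidHom.finrank_ker_add_finrank_ker_involution hs).trans
    (Set.finrank_unit (SKset F K SF))⟩
  · rw [herbrandU, hH0, hH1, hN, hD, hplus, hminus,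
      Subgroup.relIndex_map_map_of_injective _ _ hinj,
      Subgroup.relIndex_map_map_of_injective _ _ hinj, MonoidHom.herbrand_involution hs]
  · rw [← finrank_UFS (K := K), hplus]
    exact (MulEquiv.toAdditive
      (Subgroup.equivMapOfInjective _ _ hinj)).toIntLinearEquiv.finrank_eq

end Quadratic

/-- For a quadratic extension `K/F` of number fields with
`Gal(K/F) = {1, σ}`, the Herbrand quotient of the `S`-unit group satisfies
`h(G, U_{K,S}) = (1/2) ∏_{v ∈ S_F} n_v`, where `n_v` is the order of the decomposition
group of a prime of `K` above `v` (the product runs over the finite primes in `S_F` and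
all infinite primes of `F`). -/
theorem herbrand_sunits_eq_half_prod_dec_orders
    (hd : Module.finrank F K = 2) (σ : K ≃ₐ[F] K) (hσ : σ ≠ AlgEquiv.refl)
    (SF : Finset (HeightOneSpectrum (𝓞 F)))
    (wfin : HeightOneSpectrum (𝓞 F) → HeightOneSpectrum (𝓞 K))
    (hwfin : ∀ v ∈ SF, (wfin v).asIdeal.comap (algebraMap (𝓞 F) (𝓞 K)) = v.asIdeal)
    (winf : InfinitePlace F → InfinitePlace K)
    (hwinf : ∀ v : InfinitePlace F, (winf v).comap (algebraMap F K) = v) :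
    herbrandU F K σ SF =
      (1 / 2 : ℚ) * (∏ v ∈ SF, (decOrderFin F K (wfin v) : ℚ)) *
        ∏ᶠ v : InfinitePlace F, (decOrderInf F K (winf v) : ℚ) := by
  classical
  obtain ⟨a, b, hab, ha, hb⟩ := herbrandU_eq_two_pow_div hd σ hσ SF
  have hfin := natCard_SKset_add_sum hd hσ SF hwfin
  have hinf := card_infinitePlace_add_sum hd hσ hwinf
  have hposF : 0 < Fintype.card (InfinitePlace F) := Fintype.card_pos
  have hposK : 0 < Fintype.card (InfinitePlace K) := Fintype.card_pos
  rw [Units.rank] at ha hb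
  rw [hab, finprod_eq_prod_of_fintype]
  simp_rw [decOrderFin_eq hd hσ, decOrderInf_eq hd hσ]
  push_cast
  rw [Finset.prod_pow_eq_pow_sum, Finset.prod_pow_eq_pow_sum]
  set m := ∑ v ∈ SF, (if conjPrime σ (wfin v) = wfin v then 1 else 0)
  set n := ∑ v, (if (winf v).comap σ.toAlgHom.toRingHom = winf v then 1 else 0)
  have key : a + 1 = b + m + n := by omega
  have hpow : (2 : ℚ) ^ a * 2 = 2 ^ b * 2 ^ m * 2 ^ n := by
    rw [← pow_succ, key, pow_add, pow_add]
  rw [div_eq_iff (by positivity)]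
  linarith
end

section
/- Let K be a CM field with real subfield F = K⁺, G = Gal(K/F), and φ: U_K → W_K, α ↦ α/σ(α) where σ is complex conjugation. If φ(U_K) = W_K², then N U_K = U_F², U_K = U_F · W_K, #H¹(G, U_K) = 2, and (U_F : N U_K) = 2^{r_K + 1}, where r_K = rank U_K. -/
open NumberField

variable (F K : Type*) [Field F] [NumberField F] [Field K] [NumberField K] [Algebra F K]

/-- The unit group `U_K = (𝓞 K)ˣ`, realized as a subgroup of `Kˣ`. -/
noncomputable def UK : Subgroup Kˣ :=
  (Units.map (algebraMap (𝓞 K) K).toMonoidHom).range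

/-- The unit group `U_F = (𝓞 F)ˣ`, realized as a subgroup of `Kˣ`. -/
noncomputable def UFinK : Subgroup Kˣ :=
  (Units.map ((algebraMap F K).comp (algebraMap (𝓞 F) F)).toMonoidHom).range

section

variable {F K}

omit [NumberField F] [NumberField K] in
theorem normU_apply (σ : K ≃ₐ[F] K) (u : Kˣ) : normU F K σ u = u * sigmaU F K σ u := rfl

omit [NumberField F] [NumberField K] in
@[simp]
theorem val_sigmaU (σ : K ≃ₐ[F] K) (u : Kˣ) : (sigmaU F K σ u : K) = σ u := rfl

omit [NumberField K] in
theorem mem_UK_iff {u : Kˣ} :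
    u ∈ UK K ↔ IsIntegral ℤ (u : K) ∧ IsIntegral ℤ ((u⁻¹ : Kˣ) : K) := by
  constructor
  · rintro ⟨v, rfl⟩
    exact ⟨(v : 𝓞 K).isIntegral_coe, ((v⁻¹ : (𝓞 K)ˣ) : 𝓞 K).isIntegral_coe⟩
  · rintro ⟨h, h'⟩
    exact ⟨⟨⟨u, h⟩, ⟨_, h'⟩, RingOfIntegers.ext u.mul_inv, RingOfIntegers.ext u.inv_mul⟩,
      Units.ext rfl⟩

omit [NumberField F] [NumberField K] in
theorem mem_UFinK_iff [CharZero F] {u : Kˣ} :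
    u ∈ UFinK F K ↔ u ∈ UK K ∧ (u : K) ∈ Set.range (algebraMap F K) := by
  rw [mem_UK_iff]
  constructor
  · rintro ⟨v, rfl⟩
    refine ⟨⟨((v : 𝓞 F).isIntegral_coe).map (algebraMap F K).toIntAlgHom,
      (((v⁻¹ : (𝓞 F)ˣ) : 𝓞 F).isIntegral_coe).map (algebraMap F K).toIntAlgHom⟩, ⟨_, rfl⟩⟩
  · rintro ⟨⟨h, h'⟩, x, hx⟩
    have hx0 : x ≠ 0 := by
      rintro rfl
      exact u.ne_zero (by rw [← hx, map_zero])
    have hinj : Function.Injective (algebraMap F K).toIntAlgHom := (algebraMap F K).injective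
    have hi : IsIntegral ℤ x := (isIntegral_algHom_iff _ hinj).mp (by simpa [hx] using h)
    have hi' : IsIntegral ℤ x⁻¹ := (isIntegral_algHom_iff _ hinj).mp (by simpa [hx] using h')
    exact ⟨⟨⟨x, hi⟩, ⟨x⁻¹, hi'⟩, RingOfIntegers.ext (mul_inv_cancel₀ hx0),
      RingOfIntegers.ext (inv_mul_cancel₀ hx0)⟩, Units.ext hx⟩

omit [NumberField K] in
theorem torsion_le_UK : CommGroup.torsion Kˣ ≤ UK K := by
  have key : ∀ u ∈ CommGroup.torsion Kˣ, IsIntegral ℤ (u : K) := by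
    intro u hu
    obtain ⟨n, hn, h⟩ := isOfFinOrder_iff_pow_eq_one.mp ((CommGroup.mem_torsion u).mp hu)
    refine IsIntegral.of_pow hn ?_
    rw [← Units.val_pow_eq_pow_val, h]
    exact isIntegral_one
  exact fun u hu ↦ mem_UK_iff.mpr ⟨key u hu, key _ (inv_mem hu)⟩

/-- The identification of the unit group of `𝓞 K` with its image in `Kˣ`. -/
noncomputable def unitsEquivUK : (𝓞 K)ˣ ≃* UK K :=
  MonoidHom.ofInjective (Units.map_injective RingOfIntegers.coe_injective)

/-- The identification of the unit group of `𝓞 F` with its image in `Kˣ`. -/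
noncomputable def unitsEquivUFinK : (𝓞 F)ˣ ≃* UFinK F K :=
  MonoidHom.ofInjective
    (Units.map_injective ((algebraMap F K).injective.comp RingOfIntegers.coe_injective))

instance finite_torsion_units : Finite (CommGroup.torsion Kˣ) := by
  have h : CommGroup.torsion Kˣ ≤
      (Units.torsion K).map (Units.map (algebraMap (𝓞 K) K).toMonoidHom) := by
    intro u hu
    obtain ⟨v, rfl⟩ := torsion_le_UK hu
    refine ⟨v, ?_, rfl⟩
    exact (Units.map_injective RingOfIntegers.coe_injective).isOfFinOrder_iff.mp hu
  have hfin : (Units.torsion K : Set (𝓞 K)ˣ).Finite :=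
    inferInstanceAs (Finite (Units.torsion K))
  exact (hfin.image _).subset h

theorem two_dvd_card_torsion_units : 2 ∣ Nat.card (CommGroup.torsion Kˣ) := by
  have h1 : (-1 : Kˣ) ∈ CommGroup.torsion Kˣ := isOfFinOrder_iff_pow_eq_one.mpr ⟨2, by simp⟩
  have h2 : orderOf (⟨-1, h1⟩ : CommGroup.torsion Kˣ) = 2 := by
    rw [Subgroup.orderOf_mk]
    refine orderOf_eq_prime (by simp) ?_
    rw [Ne, Units.ext_iff]
    norm_num
  exact h2 ▸ orderOf_dvd_natCard _

theorem index_sq_torsion_units :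
    (powMonoidHom 2 : CommGroup.torsion Kˣ →* CommGroup.torsion Kˣ).range.index = 2 := by
  rw [IsCyclic.index_powMonoidHom_range, Nat.gcd_eq_right two_dvd_card_torsion_units]

section CM

variable [IsGalois F K] (hd : Module.finrank F K = 2) {σ : K ≃ₐ[F] K} (hσ : σ ≠ AlgEquiv.refl)

include hd hσ

theorem eq_of_ne_refl_of_ne_refl {τ : K ≃ₐ[F] K} (hτ : τ ≠ AlgEquiv.refl) : τ = σ := by
  have h : Nat.card (K ≃ₐ[F] K) = 2 := hd ▸ IsGalois.card_aut_eq_finrank F K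
  rw [Nat.card_eq_two_iff' 1] at h
  exact h.unique hτ hσ

theorem mem_range_algebraMap_of_fixed {x : K} (hx : σ x = x) :
    x ∈ Set.range (algebraMap F K) := by
  rw [IsGalois.mem_range_algebraMap_iff_fixed]
  intro τ
  by_cases hτ : τ = AlgEquiv.refl
  · simp [hτ]
  · rw [eq_of_ne_refl_of_ne_refl hd hσ hτ, hx]

theorem embedding_apply_eq_conj [IsTotallyReal F] [IsTotallyComplex K] (φ : K →+* ℂ) (x : K) :
    φ (σ x) = starRingEnd ℂ (φ x) := by
  obtain ⟨τ, hτ⟩ := InfinitePlace.exists_isConj_of_isRamified (k := F) (φ := φ)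
    (InfinitePlace.isRamified_iff.mpr
      ⟨IsTotallyComplex.isComplex _, IsTotallyReal.isReal _⟩)
  have h1 : τ ≠ AlgEquiv.refl := (ComplexEmbedding.isConj_ne_one_iff hτ).mpr
    (IsTotallyComplex.complexEmbedding_not_isReal φ)
  rw [← eq_of_ne_refl_of_ne_refl hd hσ h1, hτ.eq, RCLike.star_def]

theorem UK_inf_ker_normU [IsTotallyReal F] [IsTotallyComplex K] :
    UK K ⊓ (normU F K σ).ker = CommGroup.torsion Kˣ := by
  ext u
  have hker : u ∈ (normU F K σ).ker ↔ ∀ φ : K →+* ℂ, ‖φ u‖ = 1 := by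
    have hφ (φ : K →+* ℂ) : φ (u * σ u) = 1 ↔ ‖φ u‖ = 1 := by
      rw [map_mul, embedding_apply_eq_conj hd hσ, Complex.mul_conj']
      norm_cast
      exact pow_eq_one_iff_of_nonneg (norm_nonneg _) two_ne_zero
    rw [MonoidHom.mem_ker, normU_apply, Units.ext_iff, Units.val_mul, val_sigmaU, Units.val_one]
    constructor
    · intro h φ
      rw [← hφ, h, map_one]
    · intro h
      let φ : K →+* ℂ := Classical.arbitrary _
      exact φ.injective (by rw [(hφ φ).mpr (h φ), map_one])
  rw [Subgroup.mem_inf, hker, CommGroup.mem_torsion]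
  constructor
  · rintro ⟨hu, h⟩
    obtain ⟨n, hn, h⟩ := Embeddings.pow_eq_one_of_norm_eq_one K ℂ (mem_UK_iff.mp hu).1 h
    exact isOfFinOrder_iff_pow_eq_one.mpr ⟨n, hn, by ext; simpa using h⟩
  · refine fun hu ↦ ⟨torsion_le_UK hu, fun φ ↦ ?_⟩
    obtain ⟨n, hn, h⟩ := isOfFinOrder_iff_pow_eq_one.mp hu
    refine Complex.norm_eq_one_of_pow_eq_one (n := n) ?_ hn.ne'
    rw [← map_pow, ← Units.val_pow_eq_pow_val, h, Units.val_one, map_one]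

theorem sigmaU_of_mem_torsion [IsTotallyReal F] [IsTotallyComplex K] {ζ : Kˣ}
    (hζ : ζ ∈ CommGroup.torsion Kˣ) : sigmaU F K σ ζ = ζ⁻¹ := by
  rw [← UK_inf_ker_normU hd hσ] at hζ
  exact (inv_eq_of_mul_eq_one_right hζ.2).symm

omit hσ in
theorem card_infinitePlace_eq_of_isTotallyReal_of_isTotallyComplex
    [IsTotallyReal F] [IsTotallyComplex K] :
    Fintype.card (InfinitePlace F) = Fintype.card (InfinitePlace K) := by
  rw [InfinitePlace.card_eq_nrRealPlaces_add_nrComplexPlaces,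
    InfinitePlace.card_eq_nrRealPlaces_add_nrComplexPlaces,
    IsTotallyComplex.nrRealPlaces_eq_zero K, IsTotallyReal.nrComplexPlaces_eq_zero, zero_add,
    add_zero, ← IsTotallyReal.finrank, ← Nat.mul_left_cancel_iff zero_lt_two,
    ← IsTotallyComplex.finrank, ← Module.finrank_mul_finrank ℚ F K, mul_comm, hd]

end CM

theorem eq_one_or_neg_one_of_mem_torsion [IsTotallyReal F] {x : (𝓞 F)ˣ}
    (hx : x ∈ Units.torsion F) : x = 1 ∨ x = -1 := by
  obtain ⟨v⟩ : Nonempty (InfinitePlace F) := inferInstance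
  have hv := IsTotallyReal.isReal v
  have h := (Units.mem_torsion F).mp hx v
  rw [← InfinitePlace.norm_embedding_of_isReal hv, Real.norm_eq_abs,
    abs_eq zero_le_one] at h
  refine h.imp (fun h ↦ ?_) (fun h ↦ ?_) <;>
  · apply Units.coe_injective
    apply (InfinitePlace.embedding_of_isReal hv).injective
    simpa using h

theorem card_torsion_of_isTotallyReal [IsTotallyReal F] : Nat.card (Units.torsion F) = 2 := by
  refine (Nat.card_eq_two_iff' 1).mpr ⟨⟨-1, isOfFinOrder_iff_pow_eq_one.mpr ⟨2, by simp⟩⟩,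
    ?_, ?_⟩
  · simp [Subtype.ext_iff, Units.ext_iff, RingOfIntegers.ext_iff]
    norm_num
  · rintro ⟨y, hy⟩ hne
    exact Subtype.ext ((eq_one_or_neg_one_of_mem_torsion hy).resolve_left
      fun h ↦ hne (Subtype.ext h))

theorem map_mk'_range_powMonoidHom {A : Type*} [CommGroup A] (T : Subgroup A) (n : ℕ) :
    (powMonoidHom n : A →* A).range.map (QuotientGroup.mk' T) =
      (powMonoidHom n : A ⧸ T →* A ⧸ T).range := by
  ext x
  constructor
  · rintro ⟨_, ⟨y, rfl⟩, rfl⟩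
    exact ⟨QuotientGroup.mk' T y, rfl⟩
  · rintro ⟨y, rfl⟩
    obtain ⟨y, rfl⟩ := QuotientGroup.mk'_surjective T y
    exact ⟨_, ⟨y, rfl⟩, rfl⟩

theorem index_sq_units_of_isTotallyReal [IsTotallyReal F] :
    (powMonoidHom 2 : (𝓞 F)ˣ →* (𝓞 F)ˣ).range.index = 2 ^ (Units.rank F + 1) := by
  set P := (powMonoidHom 2 : (𝓞 F)ˣ →* (𝓞 F)ˣ).range
  set T := Units.torsion F
  have hPT : P.subgroupOf T = ⊥ := by
    refine (Subgroup.eq_bot_iff_forall _).mpr ?_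
    rintro ⟨_, hx⟩ ⟨y, rfl⟩
    have hy : y ∈ T := (isOfFinOrder_pow.mp hx).resolve_right two_ne_zero
    rcases eq_one_or_neg_one_of_mem_torsion hy with rfl | rfl <;> ext <;> simp
  have h1 : P.relIndex (P ⊔ T) = 2 := by
    rw [sup_comm, Subgroup.relIndex_sup_right, Subgroup.relIndex, hPT, Subgroup.index_bot,
      card_torsion_of_isTotallyReal]
  have h2 : (P ⊔ T).index = 2 ^ Units.rank F := by
    have hi := Subgroup.index_map P (QuotientGroup.mk' T)
    rw [QuotientGroup.ker_mk', MonoidHom.range_eq_top.mpr (QuotientGroup.mk'_surjective T),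
      Subgroup.index_top, mul_one,
      map_mk'_range_powMonoidHom] at hi
    rw [← hi, ← Units.finrank_modTorsion]
    exact AddSubgroup.index_range_nsmul (M := Additive ((𝓞 F)ˣ ⧸ T)) 2
  rw [← Subgroup.relIndex_mul_index (le_sup_left : P ≤ P ⊔ T), h1, h2, pow_succ']

omit [NumberField K] in
theorem index_sq_UFinK_of_isTotallyReal [IsTotallyReal F] :
    (((UFinK F K).map (powMonoidHom 2)).subgroupOf (UFinK F K)).index =
      2 ^ (Units.rank F + 1) := by
  rw [Subgroup.subgroupOf_map_powMonoidHom_eq_range,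
    ← MulEquiv.map_range_powMonoidHom unitsEquivUFinK, Subgroup.index_map_equiv,
    index_sq_units_of_isTotallyReal]

theorem finrank_UK : Module.finrank ℤ (Additive (UK K)) = Units.rank K := by
  rw [← Units.finrank_eq]
  exact (LinearEquiv.finrank_eq (MulEquiv.toAdditive (unitsEquivUK (K := K))).toIntLinearEquiv).symm

end

/-- Let `K` be a CM field with real subfield `F = K⁺`, `G = Gal(K/F)`
generated by complex conjugation `σ`, and `φ : U_K → W_K`, `α ↦ α/σ(α)`.  If
`φ(U_K) = W_K²`, then `N U_K = U_F²`, `U_K = U_F · W_K`, `#H¹(G, U_K) = 2`, and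
`(U_F : N U_K) = 2^{r_K + 1}` where `r_K = rank U_K`. -/
theorem cm_phi_eq_torsion_sq_conclusions
    [IsGalois F K] (hd : Module.finrank F K = 2)
    (htr : ∀ v : InfinitePlace F, v.IsReal) (htc : ∀ w : InfinitePlace K, w.IsComplex)
    (σ : K ≃ₐ[F] K) (hσ : σ ≠ AlgEquiv.refl)
    (hphi : (UK K).map (oneSubU F K σ) = (CommGroup.torsion Kˣ).map (powMonoidHom 2)) :
    (UK K).map (normU F K σ) = (UFinK F K).map (powMonoidHom 2) ∧
    UFinK F K ⊔ CommGroup.torsion Kˣ = UK K ∧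
    Nat.card ((((UK K) ⊓ (normU F K σ).ker : Subgroup Kˣ)) ⧸
        (((UK K).map (oneSubU F K σ)).subgroupOf ((UK K) ⊓ (normU F K σ).ker : Subgroup Kˣ))) = 2 ∧
    Nat.card (UFinK F K ⧸ (((UK K).map (normU F K σ)).subgroupOf (UFinK F K))) =
      2 ^ (Module.finrank ℤ (Additive (UK K)) + 1) := by
  have : IsTotallyReal F := ⟨htr⟩
  have : IsTotallyComplex K := ⟨htc⟩
  have htor := UK_inf_ker_normU hd hσ
  have hsup : UFinK F K ⊔ CommGroup.torsion Kˣ = UK K := by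
    refine le_antisymm (sup_le (fun u hu ↦ (mem_UFinK_iff.mp hu).1) torsion_le_UK) fun u hu ↦ ?_
    obtain ⟨ζ, hζ, h⟩ := hphi.le ⟨u, hu, rfl⟩
    have hfix : sigmaU F K σ (u * ζ⁻¹) = u * ζ⁻¹ := by
      rw [map_mul, map_inv, sigmaU_of_mem_torsion hd hσ hζ, inv_inv, eq_mul_inv_iff_mul_eq,
        mul_assoc, ← pow_two, mul_comm, ← eq_div_iff_mul_eq']
      exact h
    refine Subgroup.mem_sup.mpr ⟨u * ζ⁻¹, mem_UFinK_iff.mpr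
      ⟨mul_mem hu (inv_mem (torsion_le_UK hζ)), ?_⟩, ζ, hζ, by simp⟩
    exact mem_range_algebraMap_of_fixed hd hσ (congrArg Units.val hfix)
  have hnormF : ∀ v ∈ UFinK F K, normU F K σ v = v ^ 2 := by
    intro v hv
    obtain ⟨x, hx⟩ := (mem_UFinK_iff.mp hv).2
    rw [normU_apply, pow_two]
    congr 1
    ext
    rw [val_sigmaU, ← hx, AlgEquiv.commutes]
  have hnorm : (UK K).map (normU F K σ) = (UFinK F K).map (powMonoidHom 2) := by
    have hW : (CommGroup.torsion Kˣ).map (normU F K σ) = ⊥ := by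
      rw [Subgroup.map_eq_bot_iff, ← htor]
      exact inf_le_right
    rw [← hsup, Subgroup.map_sup, hW, sup_bot_eq]
    ext u
    exact exists_congr fun v ↦ and_congr_right fun hv ↦ by rw [hnormF v hv]; rfl
  refine ⟨hnorm, hsup, ?_, ?_⟩
  · rw [hphi, htor, Subgroup.subgroupOf_map_powMonoidHom_eq_range]
    exact index_sq_torsion_units
  · rw [hnorm, finrank_UK, Units.rank,
      ← card_infinitePlace_eq_of_isTotallyReal_of_isTotallyComplex hd]
    exact index_sq_UFinK_of_isTotallyReal
end
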